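/- Let d be a square-free integer whose prime divisors are all congruent to ±3 (mod 8) or ±7 (mod 16). Then for every integer n ≥ 4, rank_2(Cl(Q(ζ_{2^n}, √d))) = rank_2(Cl(Q(ζ_16, √d))). -/

import Mathlib

open NumberField IntermediateField

/-- The 2-rank of the class group: dim_{F₂} Cl(K)/Cl(K)². -/
noncomputable def rank2 (K : Type*) [Field K] [NumberField K] : ℕ :=
  Nat.log 2 (Nat.card
    (ClassGroup (𝓞 K) ⧸ Subgroup.closure {x : ClassGroup (𝓞 K) | ∃ y, x = y ^ 2}))

set_option linter.unusedSectionVars false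

namespace QuadraticGenus

section Involution

theorem relIndex_eq_of_correspondence {M G H : Type*} [Group M] [Group G] [Group H]
    (Z : Subgroup M) (f : M →* G) (g : M →* H) {G₀ G₁ : Subgroup G} {H₀ H₁ : Subgroup H}
    (hG : Z.map f = G₀) (hH : Z.map g = H₀) (h : ∀ z ∈ Z, f z ∈ G₁ ↔ g z ∈ H₁) : G₁.relIndex G₀ = H₁.relIndex H₀ := by
  rw [← hG, ← hH, ← Subgroup.relIndex_comap, ← Subgroup.relIndex_comap,
    ← Subgroup.inf_relIndex_right, ← Subgroup.inf_relIndex_right (H₁.comap _)]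
  congr 1
  ext z
  simp only [Subgroup.mem_inf, Subgroup.mem_comap]
  exact ⟨fun ⟨a, b⟩ => ⟨(h z b).1 a, b⟩, fun ⟨a, b⟩ => ⟨(h z b).2 a, b⟩⟩

variable {X : Type*} [CommGroup X]

/-- The elements fixed by the endomorphism `s`. -/
def fix (s : X →* X) : Subgroup X := s.eqLocus (MonoidHom.id X)

/-- The map `x ↦ x * s x`. -/
def nm (s : X →* X) : X →* X := MonoidHom.id X * s

/-- The map `x ↦ x / s x`. -/
def df (s : X →* X) : X →* X := MonoidHom.id X / s

theorem mem_fix {s : X →* X} {x : X} : x ∈ fix s ↔ s x = x := Iff.rfl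

theorem nm_apply (s : X →* X) (x : X) : nm s x = x * s x := rfl

theorem df_apply (s : X →* X) (x : X) : df s x = x / s x := rfl

theorem nm_df {s : X →* X} (hs : ∀ x, s (s x) = x) (x : X) : nm s (df s x) = 1 := by
  simp [nm_apply, df_apply, hs]

theorem sq_mul_nm {s : X →* X} (x : X) : x ^ 2 = df s x * nm s x := by
  simp only [nm_apply, df_apply, pow_two]
  rw [div_mul_eq_mul_div, mul_left_comm, mul_div_assoc, mul_div_cancel_right]

theorem mem_of_odd_pow {H : Subgroup X} {x : X} {h : ℕ} (hh : Odd h) (h1 : x ^ h ∈ H)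
    (h2 : x ^ 2 ∈ H) : x ∈ H := by
  obtain ⟨k, rfl⟩ := hh
  rw [pow_succ, pow_mul] at h1
  exact (H.mul_mem_cancel_left (H.pow_mem h2 k)).1 h1

variable {I : Type*} [CommGroup I] {s : X →* X} {t : I →* I} {δ : X →* I}

theorem ambiguous_relIndex (hs : ∀ x, s (s x) = x) (ht : ∀ x, t (t x) = x)
    (hδ : ∀ x, δ (s x) = t (δ x))
    (hX : ∀ x, nm s x = 1 → ∃ y, x = df s y) (hI : ∀ a, nm t a = 1 → ∃ b, a = df t b)
    {J : Subgroup I} (hJt : J ≤ fix t) (hnJ : ∀ a, nm t a ∈ J)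
    (hXJ : ∀ x ∈ fix s, δ x ∈ J) {h : ℕ} (hh : Odd h)
    (hJX : ∀ j ∈ J, ∃ x ∈ fix s, δ x = j ^ h) :
    δ.range.relIndex (δ.range.comap (powMonoidHom 2)) *
        (nm s).range.relIndex (δ.ker ⊓ fix s) *
        (δ.ker.map (df s)).relIndex (δ.ker ⊓ (nm s).ker) =
      J.relIndex (fix t) * (δ.ker.map (nm s)).relIndex (δ.ker ⊓ fix s) := by
  have hδn : ∀ x, δ (nm s x) = nm t (δ x) := fun x => by simp [nm_apply, hδ]
  have hδd : ∀ x, δ (df s x) = df t (δ x) := fun x => by simp [df_apply, hδ]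
  have hsq : ∀ a ∈ fix t, a ^ 2 ∈ J := fun a ha => by
    have := hnJ a
    rwa [nm_apply, mem_fix.1 ha, ← pow_two] at this
  have hJr : ∀ j ∈ J, j ^ h ∈ δ.range := fun j hj => by
    obtain ⟨x, -, hx⟩ := hJX j hj
    exact ⟨x, hx⟩
  have hfixdf : ∀ a, a ∈ fix t ↔ df t a = 1 := fun a => by
    rw [mem_fix, df_apply, div_eq_one, eq_comm]
  have hfixs : ∀ a, a ∈ fix s ↔ df s a = 1 := fun a => by
    rw [mem_fix, df_apply, div_eq_one, eq_comm]
  set P := δ.range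
  set A := P.comap (powMonoidHom 2) with hA
  have memA : ∀ a, a ∈ A ↔ a ^ 2 ∈ P := fun a => Iff.rfl
  set W := P.comap (powMonoidHom h) ⊓ fix t with hW
  set A₁ := (fix t).map (powMonoidHom h) ⊔ P with hA₁
  set Y := (fix t).comap δ with hY
  have hWY : W = Y.map δ ⊔ J := by
    apply le_antisymm
    · rintro a ⟨⟨y, hy⟩, ha⟩
      have ha2 := hsq a ha
      refine mem_of_odd_pow hh ?_ (Subgroup.mem_sup_right ha2)
      refine Subgroup.mem_sup_left ⟨y, ?_, hy⟩
      change δ y ∈ fix t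
      rw [hy]
      exact (fix t).pow_mem ha h
    · rw [sup_le_iff]
      constructor
      · rintro _ ⟨y, hy, rfl⟩
        exact ⟨P.pow_mem ⟨y, rfl⟩ h, hy⟩
      · exact fun j hj => ⟨hJr j hj, hJt hj⟩
  have hJW : J ≤ W := hWY ▸ le_sup_right
  have e1 : J.relIndex (fix t) = J.relIndex W * P.relIndex A₁ := by
    rw [← Subgroup.relIndex_mul_relIndex J W (fix t) hJW inf_le_right]
    congr 1
    rw [hA₁, Subgroup.relIndex_sup_right, ← Subgroup.relIndex_comap, hW,
      Subgroup.inf_relIndex_right]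
  have hA₁A : A₁ ≤ A := by
    rw [hA₁, sup_le_iff]
    constructor
    · rintro _ ⟨a, ha, rfl⟩
      change (a ^ h) ^ 2 ∈ P
      rw [← pow_mul, mul_comm, pow_mul]
      exact hJr _ (hsq a ha)
    · exact fun a ha => P.pow_mem ha 2
  have e2 : P.relIndex A = P.relIndex A₁ * A₁.relIndex A :=
    (Subgroup.relIndex_mul_relIndex P A₁ A le_sup_right hA₁A).symm
  have hDE : ∀ y ∈ Y, δ y ∈ J ↔ df s y ∈ δ.ker.map (df s) := by
    intro y hy
    constructor
    · intro hj
      obtain ⟨x, hx, hxj⟩ := hJX _ hj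
      obtain ⟨k, hk⟩ := hh
      have hyt : nm t (δ y) = δ y ^ 2 := by rw [nm_apply, mem_fix.1 hy, pow_two]
      refine ⟨y * nm s y ^ k / x, ?_, ?_⟩
      · change δ _ = 1
        rw [map_div, map_mul, map_pow, hδn, hyt, hxj, hk, ← pow_mul, pow_succ', div_self']
      · have : df s (nm s y) = 1 := by simp [df_apply, nm_apply, hs, mul_comm]
        rw [map_div, map_mul, map_pow, this, (hfixs x).1 hx]
        simp
    · rintro ⟨e, he, hey⟩
      have : y / e ∈ fix s := by rw [hfixs, map_div, hey, div_self']
      have := hXJ _ this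
      rwa [map_div, MonoidHom.mem_ker.1 he, div_one] at this
  have hYE : Y.map (df s) = δ.ker ⊓ (nm s).ker := by
    ext e
    constructor
    · rintro ⟨y, hy, rfl⟩
      refine ⟨?_, nm_df hs y⟩
      change δ _ = 1
      rw [hδd]
      exact (hfixdf _).1 hy
    · rintro ⟨he, hn⟩
      obtain ⟨y, rfl⟩ := hX e hn
      refine ⟨y, ?_, rfl⟩
      change δ y ∈ fix t
      rw [hfixdf, ← hδd]
      exact he
  have e3 : (δ.ker.map (df s)).relIndex (δ.ker ⊓ (nm s).ker) = J.relIndex W := by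
    rw [hWY, Subgroup.relIndex_sup_right, ← hYE, ← Subgroup.relIndex_comap,
      ← Subgroup.relIndex_comap, ← Subgroup.inf_relIndex_right,
      ← Subgroup.inf_relIndex_right (J.comap δ)]
    congr 1
    ext y
    exact ⟨fun ⟨a, b⟩ => ⟨(hDE y b).2 a, b⟩, fun ⟨a, b⟩ => ⟨(hDE y b).1 a, b⟩⟩
  have hNE : δ.ker.map (nm s) ≤ δ.ker ⊓ fix s := by
    rintro _ ⟨e, he, rfl⟩
    refine ⟨?_, ?_⟩
    · change δ _ = 1
      rw [hδn, MonoidHom.mem_ker.1 he, map_one]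
    · change s _ = _
      simp [nm_apply, hs, mul_comm]
  have hAmem : ∀ a, nm t a ∈ P → (a ∈ A ↔ df t a ∈ P) := fun a ha => by
    rw [memA, sq_mul_nm (s := t) a]
    exact P.mul_mem_cancel_right ha
  have hnA : ∀ a, a ∈ A → nm t a ∈ P := fun a ha => by
    refine mem_of_odd_pow hh (hJr _ (hnJ a)) ?_
    obtain ⟨x, hx⟩ := ha
    refine ⟨nm s x, ?_⟩
    rw [hδn, hx, powMonoidHom_apply, map_pow]
  have e4 : A₁.relIndex A =
      (δ.ker.map (nm s)).relIndex ((δ.ker ⊓ fix s) ⊓ (nm s).range) := by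
    let Z : Subgroup (I × X) :=
      (((df t).comp (MonoidHom.fst I X)).eqLocus (δ.comp (MonoidHom.snd I X))) ⊓
        A.comap (MonoidHom.fst I X)
    have hZ : ∀ z, z ∈ Z ↔ df t z.1 = δ z.2 ∧ z.1 ∈ A := fun z => Iff.rfl
    refine relIndex_eq_of_correspondence Z (MonoidHom.fst I X)
      ((nm s).comp (MonoidHom.snd I X)) ?_ ?_ ?_
    · ext a
      constructor
      · rintro ⟨z, hz, rfl⟩
        exact ((hZ z).1 hz).2
      · intro ha
        obtain ⟨x, hx⟩ := (hAmem a (hnA a ha)).1 ha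
        exact ⟨(a, x), (hZ _).2 ⟨hx.symm, ha⟩, rfl⟩
    · ext u
      constructor
      · rintro ⟨z, hz, rfl⟩
        obtain ⟨h1, h2⟩ := (hZ z).1 hz
        refine ⟨⟨?_, ?_⟩, z.2, rfl⟩
        · change δ (nm s z.2) = 1
          rw [hδn, ← h1, nm_df ht]
        · change s (nm s z.2) = nm s z.2
          simp [nm_apply, hs, mul_comm]
      · rintro ⟨⟨h1, h2⟩, x, rfl⟩
        obtain ⟨b, hb⟩ := hI (δ x) (by rw [← hδn]; exact h1)
        obtain ⟨k, hk⟩ := id hh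
        refine ⟨(b ^ h, x ^ h / nm s x ^ k), (hZ _).2 ⟨?_, ?_⟩, ?_⟩
        · rw [map_div, map_pow, map_pow, map_pow, MonoidHom.mem_ker.1 h1, hb]
          simp
        · rw [hAmem]
          · rw [map_pow, ← hb]
            exact P.pow_mem ⟨x, rfl⟩ h
          · rw [map_pow]
            exact hJr _ (hnJ b)
        · change nm s (x ^ h / nm s x ^ k) = nm s x
          have : nm s (nm s x) = nm s x ^ 2 := by
            rw [nm_apply s (nm s x), mem_fix.1 h2, pow_two]
          rw [map_div, map_pow, map_pow, this, hk, ← pow_mul, pow_succ, mul_div_cancel_left]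
    · rintro ⟨a, x⟩ hz
      obtain ⟨h1, h2⟩ := (hZ _).1 hz
      dsimp only at h1 h2
      change a ∈ A₁ ↔ nm s x ∈ δ.ker.map (nm s)
      constructor
      · intro ha
        obtain ⟨_, ⟨b, hb, rfl⟩, _, ⟨y, rfl⟩, rfl⟩ := Subgroup.mem_sup.1 ha
        rw [map_mul, powMonoidHom_apply, map_pow, (hfixdf b).1 hb, one_pow, one_mul,
          ← hδd] at h1
        refine ⟨x / df s y, ?_, ?_⟩
        · change δ _ = 1
          rw [map_div, h1, div_self']
        · rw [map_div, nm_df hs, div_one]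
      · rintro ⟨e, he, hex⟩
        obtain ⟨y, hy⟩ := hX (x / e) (by rw [map_div, hex, div_self'])
        have hb : a / δ y ∈ fix t := by
          rw [hfixdf, map_div, h1, ← hδd, ← hy, map_div, MonoidHom.mem_ker.1 he, div_one,
            div_self']
        refine mem_of_odd_pow hh ?_ (Subgroup.mem_sup_right h2)
        refine Subgroup.mem_sup.2 ⟨_, ⟨_, hb, rfl⟩, δ (y ^ h), ⟨_, rfl⟩, ?_⟩
        rw [powMonoidHom_apply, map_pow, ← mul_pow, div_mul_cancel]
  rw [e2, e1, e3, ← Subgroup.relIndex_mul_relIndex (δ.ker.map (nm s))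
    ((δ.ker ⊓ fix s) ⊓ (nm s).range) (δ.ker ⊓ fix s) ?_ inf_le_left,
    Subgroup.inf_relIndex_left, ← e4]
  · ring
  · refine le_inf hNE ?_
    rintro _ ⟨e, he, rfl⟩
    exact ⟨e, rfl⟩

end Involution

section Herbrand

variable {X : Type*} [CommGroup X]

theorem relIndex_map_mul_relIndex_sup {E E₁ E₂ : Subgroup X} (g : X →* X) (h₁ : E₁ ≤ E)
    (hg : E.map g ≤ E₁) (h₂ : E₂ = E ⊓ g.ker) (hsq : ∀ x ∈ E₁, g x = x ^ 2) :
    (E.map g).relIndex E₁ * (E₁ ⊔ E₂).relIndex E =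
      (E₁.map (powMonoidHom 2)).relIndex E₁ := by
  have h₂' : E₂ ≤ E := h₂ ▸ inf_le_left
  have hmap : (E₁ ⊔ E₂).map g = E₁.map (powMonoidHom 2) := by
    rw [Subgroup.map_sup, (Subgroup.map_eq_bot_iff E₂).2 (h₂ ▸ inf_le_right), sup_bot_eq]
    ext x
    constructor
    · rintro ⟨y, hy, rfl⟩
      exact ⟨y, hy, (hsq y hy).symm⟩
    · rintro ⟨y, hy, rfl⟩
      exact ⟨y, hy, hsq y hy⟩
  have hcomap : ((E₁ ⊔ E₂).map g).comap g ⊓ E = E₁ ⊔ E₂ := by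
    apply le_antisymm
    · rintro x ⟨⟨y, hy, hxy⟩, hx⟩
      have : x / y ∈ E₂ := by
        rw [h₂]
        refine ⟨E.div_mem hx (sup_le h₁ h₂' hy), ?_⟩
        change g _ = 1
        rw [map_div, hxy, div_self']
      rw [← div_mul_cancel x y]
      exact mul_mem (Subgroup.mem_sup_right this) hy
    · exact le_inf (Subgroup.le_comap_map _ _) (sup_le h₁ h₂')
  have key : (E₁.map (powMonoidHom 2)).relIndex (E.map g) = (E₁ ⊔ E₂).relIndex E := by
    rw [← hmap, ← Subgroup.relIndex_comap, ← Subgroup.inf_relIndex_right, hcomap]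
  rw [← key, mul_comm, Subgroup.relIndex_mul_relIndex _ _ _ ?_ hg]
  rw [← hmap]
  exact Subgroup.map_mono (sup_le h₁ h₂')

variable {s : X →* X} {E : Subgroup X}

theorem relIndex_sq_mul_relIndex_sq (hs : ∀ x, s (s x) = x) (hE : ∀ x ∈ E, s x ∈ E) {i m : X}
    (hi : i ∈ E) (hsi : s i = i) (him : i ^ 2 = m) (hm2 : m ^ 2 = 1) (hm : m ≠ 1)
    (hX : ∀ x : X, x ^ 2 = 1 → x = 1 ∨ x = m)
    (hfin : (E.map (powMonoidHom 2)).relIndex E ≠ 0) :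
    ((E ⊓ fix s).map (powMonoidHom 2)).relIndex (E ⊓ fix s) *
      ((E ⊓ (nm s).ker).map (powMonoidHom 2)).relIndex (E ⊓ (nm s).ker) =
      2 * (E.map (powMonoidHom 2)).relIndex E ∧ (E ⊓ fix s ⊔ E ⊓ (nm s).ker).relIndex E ≠ 0 := by
  set E₁ := E ⊓ fix s with hE₁
  set E₂ := E ⊓ (nm s).ker with hE₂
  set sq : X →* X := powMonoidHom 2
  have sqa : ∀ x, sq x = x ^ 2 := fun _ => rfl
  set B := E₁ ⊔ E₂ with hB
  have hBE : B ≤ E := sup_le inf_le_left inf_le_left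
  have hmE : m ∈ E := him ▸ E.pow_mem hi 2
  have hsm : s m = m := by rw [← him, map_pow, hsi]
  have hm₁ : m ∈ E₁ := ⟨hmE, hsm⟩
  have hm₂ : m ∈ E₂ := ⟨hmE, by change m * s m = 1; rw [hsm, ← pow_two, hm2]⟩
  have hi₁ : i ∈ E₁ := ⟨hi, hsi⟩
  have hsqEB : E.map sq ≤ B := by
    rintro _ ⟨x, hx, rfl⟩
    rw [sqa, sq_mul_nm (s := s), mul_comm]
    refine Subgroup.mul_mem_sup ⟨E.mul_mem hx (hE x hx), ?_⟩ ⟨E.div_mem hx (hE x hx), nm_df hs x⟩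
    change s (x * s x) = x * s x
    rw [map_mul, hs, mul_comm]
  have hc : B.relIndex E ≠ 0 := fun h0 => hfin (by
    have := Subgroup.relIndex_mul_relIndex (E.map sq) B E hsqEB hBE
    rw [h0, mul_zero] at this
    exact this.symm)
  refine ⟨?_, hc⟩
  have e1 : (E.map sq).relIndex E = (B.map sq).relIndex B := by
    have h1 : (B.map sq).relIndex (E.map sq) = B.relIndex E := by
      rw [← Subgroup.relIndex_comap, ← Subgroup.inf_relIndex_right]
      congr 1
      apply le_antisymm
      · rintro x ⟨⟨y, hy, hxy⟩, hx⟩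
        have : (x / y) ^ 2 = 1 := by
          rw [div_pow, ← sqa, ← sqa, hxy, div_self']
        have h2 : x / y ∈ B := by
          rcases hX _ this with h | h <;> rw [h]
          · exact one_mem _
          · exact Subgroup.mem_sup_left hm₁
        rw [← div_mul_cancel x y]
        exact mul_mem h2 hy
      · exact le_inf (Subgroup.le_comap_map _ _) hBE
    have h2 := Subgroup.relIndex_mul_relIndex (B.map sq) (E.map sq) E (Subgroup.map_mono hBE)
      (hsqEB.trans hBE)
    have h3 := Subgroup.relIndex_mul_relIndex (B.map sq) B E
      ((Subgroup.map_mono hBE).trans hsqEB) hBE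
    rw [h1, ← h3, mul_comm] at h2
    exact Nat.eq_of_mul_eq_mul_right (Nat.pos_of_ne_zero hc) h2
  have hsq₁ : E₁.map sq ≤ E₁ := by
    rintro _ ⟨x, hx, rfl⟩
    exact pow_mem hx 2
  have hsq₂ : E₂.map sq ≤ E₂ := by
    rintro _ ⟨x, hx, rfl⟩
    exact pow_mem hx 2
  have hinter : ∀ x ∈ E₁, x ∈ E₂ → x = 1 ∨ x = m := fun x h1 h2 => by
    refine hX x ?_
    have : x * s x = 1 := h2.2
    rwa [mem_fix.1 h1.2, ← pow_two] at this
  have e2 : (B.map sq).relIndex B = (E₁.map sq ⊔ E₂).relIndex E₁ *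
      (E₁.map sq ⊔ E₂.map sq).relIndex E₂ := by
    rw [hB, Subgroup.map_sup, ← Subgroup.relIndex_mul_relIndex (E₁.map sq ⊔ E₂.map sq)
      (E₁.map sq ⊔ E₂) (E₁ ⊔ E₂) (sup_le_sup_left hsq₂ _) (sup_le_sup_right hsq₁ _), mul_comm]
    congr 1
    · rw [show E₁ ⊔ E₂ = E₁ ⊔ (E₁.map sq ⊔ E₂) by
        rw [← sup_assoc, sup_eq_left.2 hsq₁], Subgroup.relIndex_sup_right]
    · rw [show E₁.map sq ⊔ E₂ = E₂ ⊔ (E₁.map sq ⊔ E₂.map sq) by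
        rw [sup_comm (E₁.map sq) (E₂.map sq), ← sup_assoc, sup_eq_left.2 hsq₂, sup_comm],
        Subgroup.relIndex_sup_right]
  have e3 : (E₁.map sq ⊔ E₂).relIndex E₁ = (E₁.map sq).relIndex E₁ := by
    rw [← Subgroup.inf_relIndex_right]
    congr 1
    apply le_antisymm
    · rintro x ⟨hx, hx₁⟩
      obtain ⟨a, ha, b, hb, rfl⟩ := Subgroup.mem_sup.1 hx
      have hb1 : b ∈ E₁ := (E₁.mul_mem_cancel_left (hsq₁ ha)).1 hx₁
      refine mul_mem ha ?_
      rcases hinter b hb1 hb with rfl | rfl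
      · exact one_mem _
      · exact ⟨i, hi₁, him⟩
    · exact le_inf le_sup_left hsq₁
  have e4 : (E₂.map sq).relIndex E₂ = 2 * (E₁.map sq ⊔ E₂.map sq).relIndex E₂ := by
    have h0 : (E₁.map sq ⊔ E₂.map sq) ⊓ E₂ = Subgroup.zpowers m ⊔ E₂.map sq := by
      apply le_antisymm
      · rintro x ⟨hx, hx₂⟩
        obtain ⟨a, ha, b, hb, rfl⟩ := Subgroup.mem_sup.1 hx
        have ha2 : a ∈ E₂ := (E₂.mul_mem_cancel_right (hsq₂ hb)).1 hx₂
        refine mul_mem ?_ (Subgroup.mem_sup_right hb)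
        rcases hinter a (hsq₁ ha) ha2 with rfl | rfl
        · exact one_mem _
        · exact Subgroup.mem_sup_left (Subgroup.mem_zpowers _)
      · rw [sup_le_iff, Subgroup.zpowers_le]
        exact ⟨⟨Subgroup.mem_sup_left ⟨i, hi₁, him⟩, hm₂⟩, le_inf le_sup_right hsq₂⟩
    have h1 : (E₂.map sq).relIndex (Subgroup.zpowers m ⊔ E₂.map sq) = 2 := by
      rw [Subgroup.relIndex_sup_right, ← Subgroup.inf_relIndex_right]
      have : E₂.map sq ⊓ Subgroup.zpowers m = ⊥ := by
        rw [eq_bot_iff]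
        rintro x ⟨⟨y, hy, hyx⟩, hxm⟩
        rw [Subgroup.mem_bot]
        have hx2 : x ^ 2 = 1 := by
          obtain ⟨k, rfl⟩ := Subgroup.mem_zpowers_iff.1 hxm
          rw [← zpow_natCast, zpow_comm, zpow_natCast, hm2, one_zpow]
        rcases hX x hx2 with h | h
        · exact h
        · exfalso
          have h3 : (y / i) ^ 2 = 1 := by
            rw [div_pow, ← sqa, hyx, h, him, div_self']
          have hy1 : y ∈ E₁ := by
            rw [← div_mul_cancel y i]
            refine mul_mem ?_ hi₁
            rcases hX _ h3 with h4 | h4 <;> rw [h4]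
            exacts [one_mem _, hm₁]
          have : y ^ 2 = 1 := by
            rcases hinter y hy1 hy with h5 | h5 <;> simp [h5, hm2]
          exact hm (by rw [← h, ← hyx, sqa, this])
      rw [this, Subgroup.relIndex_bot_left, Nat.card_zpowers]
      exact orderOf_eq_prime hm2 hm
    rw [← Subgroup.inf_relIndex_right (E₁.map sq ⊔ E₂.map sq), h0, ← h1,
      Subgroup.relIndex_mul_relIndex _ _ _ le_sup_right]
    rw [← h0]
    exact inf_le_right
  rw [e1, e2, e3, e4]
  ring

/-- The Herbrand quotient of a group of units of unit ranks `ρ` and `2 * ρ + 1` is `1 / 2`. -/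
theorem herbrand (hs : ∀ x, s (s x) = x) (hE : ∀ x ∈ E, s x ∈ E) {i m : X}
    (hi : i ∈ E) (hsi : s i = i) (him : i ^ 2 = m) (hm2 : m ^ 2 = 1) (hm : m ≠ 1)
    (hX : ∀ x : X, x ^ 2 = 1 → x = 1 ∨ x = m) {ρ : ℕ}
    (hr : (E.map (powMonoidHom 2)).relIndex E = 2 ^ (2 * ρ + 2))
    (hr₁ : ((E ⊓ fix s).map (powMonoidHom 2)).relIndex (E ⊓ fix s) = 2 ^ (ρ + 1)) :
    (E.map (df s)).relIndex (E ⊓ (nm s).ker) = 2 * (E.map (nm s)).relIndex (E ⊓ fix s) ∧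
      (E.map (nm s)).relIndex (E ⊓ fix s) ≠ 0 := by
  obtain ⟨h1, h2⟩ := relIndex_sq_mul_relIndex_sq hs hE hi hsi him hm2 hm hX (by rw [hr]; positivity)
  have h3 := relIndex_map_mul_relIndex_sup (E := E) (E₁ := E ⊓ fix s) (E₂ := E ⊓ (nm s).ker)
    (nm s) inf_le_left ?_ rfl ?_
  · have h4 := relIndex_map_mul_relIndex_sup (E := E) (E₁ := E ⊓ (nm s).ker) (E₂ := E ⊓ fix s)
      (df s) inf_le_left ?_ ?_ ?_
    · rw [sup_comm] at h4
      rw [hr₁] at h1 h3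
      rw [hr] at h1
      have h5 : ((E ⊓ (nm s).ker).map (powMonoidHom 2)).relIndex (E ⊓ (nm s).ker) =
          2 * 2 ^ (ρ + 1) := by
        have : 0 < 2 ^ (ρ + 1) := by positivity
        refine Nat.eq_of_mul_eq_mul_left this ?_
        rw [h1]
        ring
      rw [h5, ← h3, ← mul_assoc] at h4
      refine ⟨Nat.eq_of_mul_eq_mul_right (Nat.pos_of_ne_zero h2) h4, ?_⟩
      rintro h
      rw [h, zero_mul] at h3
      exact absurd h3.symm (by positivity)
    · rintro _ ⟨x, hx, rfl⟩
      exact ⟨E.div_mem hx (hE x hx), nm_df hs x⟩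
    · ext x
      rw [Subgroup.mem_inf, Subgroup.mem_inf, mem_fix, MonoidHom.mem_ker, df_apply, div_eq_one,
        eq_comm (a := x)]
    · rintro x ⟨-, hx⟩
      rw [sq_mul_nm (s := s), MonoidHom.mem_ker.1 hx, mul_one]
  · rintro _ ⟨x, hx, rfl⟩
    refine ⟨E.mul_mem hx (hE x hx), ?_⟩
    change s _ = _
    simp [nm_apply, hs, mul_comm]
  · rintro x ⟨-, hx⟩
    rw [nm_apply, mem_fix.1 hx, pow_two]

end Herbrand

section UnitIndex

open NumberField

theorem index_range_sq_units (F : Type*) [Field F] [NumberField F] :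
    (powMonoidHom 2 : (𝓞 F)ˣ →* (𝓞 F)ˣ).range.index = 2 ^ (Units.rank F + 1) := by
  set T := Units.torsion F
  set sq : (𝓞 F)ˣ →* (𝓞 F)ˣ := powMonoidHom 2
  have h1 : (sq.range ⊔ T).index = 2 ^ Units.rank F := by
    have h := AddSubgroup.index_range_nsmul (Additive ((𝓞 F)ˣ ⧸ T)) 2
    rw [Units.finrank_modTorsion] at h
    rw [← h]
    have : sq.range ⊔ T = (powMonoidHom (α := (𝓞 F)ˣ ⧸ T) 2).range.comap (QuotientGroup.mk' T) := by
      apply le_antisymm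
      · rw [sup_le_iff]
        constructor
        · rintro _ ⟨x, rfl⟩
          exact ⟨QuotientGroup.mk' T x, by simp [sq]⟩
        · intro x hx
          exact ⟨1, by simp; exact ((QuotientGroup.eq_one_iff x).2 hx).symm⟩
      · rintro x ⟨y, hy⟩
        obtain ⟨y, rfl⟩ := QuotientGroup.mk'_surjective T y
        have : x / sq y ∈ T := by
          rw [← QuotientGroup.ker_mk' T, MonoidHom.mem_ker, map_div, ← hy]
          simp [sq]
        rw [← div_mul_cancel x (sq y)]
        exact mul_mem (Subgroup.mem_sup_right this) (Subgroup.mem_sup_left ⟨y, rfl⟩)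
    rw [this, Subgroup.index_comap_of_surjective _ (QuotientGroup.mk'_surjective T)]
    exact Subgroup.index_toAddSubgroup.symm
  have h2 : sq.range.relIndex T = 2 := by
    have : (powMonoidHom 2 : T →* T).range.index = 2 := by
      rw [IsCyclic.index_powMonoidHom_range, Nat.gcd_eq_right_iff_dvd]
      exact Even.two_dvd <| Units.even_torsionOrder F
    rw [← this, Subgroup.relIndex]
    congr 1
    ext ⟨x, hx⟩
    constructor
    · rintro ⟨y, hy⟩
      refine ⟨⟨y, ?_⟩, Subtype.ext hy⟩
      change IsOfFinOrder x at hx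
      change IsOfFinOrder y
      change y ^ 2 = x at hy
      rw [← hy] at hx
      exact hx.of_pow two_ne_zero
    · rintro ⟨y, hy⟩
      exact ⟨y, congrArg Subtype.val hy⟩
  rw [← Subgroup.relIndex_mul_index (le_sup_left : sq.range ≤ sq.range ⊔ T), h1,
    sup_comm, Subgroup.relIndex_sup_right, h2, pow_succ, mul_comm]

end UnitIndex

section Quadratic

variable {K L : Type*} [Field K] [NumberField K] [Field L] [NumberField L] [Algebra K L]
  [Algebra.IsQuadraticExtension K L] {σ : L ≃ₐ[K] L}

/-- The action of an automorphism on the ring of integers. -/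
noncomputable abbrev conj (σ : L ≃ₐ[K] L) : 𝓞 L ≃ₐ[𝓞 K] 𝓞 L := RingOfIntegers.mapAlgEquiv σ

theorem coe_conj (σ : L ≃ₐ[K] L) (x : 𝓞 L) : ((conj σ x : 𝓞 L) : L) = σ x := rfl

theorem aut_eq (hσ : σ ≠ 1) (τ : L ≃ₐ[K] L) : τ = 1 ∨ τ = σ := by
  have h := IsGalois.card_aut_eq_finrank K L
  rw [Algebra.IsQuadraticExtension.finrank_eq_two] at h
  obtain ⟨y, -, hy⟩ := (Nat.card_eq_two_iff' (1 : L ≃ₐ[K] L)).1 h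
  by_cases ht : τ = 1
  · exact Or.inl ht
  · exact Or.inr ((hy τ ht).trans (hy σ hσ).symm)

theorem aut_aut (hσ : σ ≠ 1) (x : L) : σ (σ x) = x := by
  rcases aut_eq hσ (σ * σ) with h | h
  · exact congrArg (fun f : L ≃ₐ[K] L => f x) h
  · exact absurd (mul_eq_left.1 h) hσ

theorem conj_conj (hσ : σ ≠ 1) (x : 𝓞 L) : conj σ (conj σ x) = x :=
  RingOfIntegers.ext (aut_aut hσ x)

theorem exists_algebraMap_eq (hσ : σ ≠ 1) {x : L} (h : σ x = x) : ∃ a : K, algebraMap K L a = x := by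
  have : x ∈ (⊥ : IntermediateField K L) := by
    rw [IsGalois.mem_bot_iff_fixed]
    intro f
    rcases aut_eq hσ f with rfl | rfl
    · rfl
    · exact h
  exact IntermediateField.mem_bot.1 this

theorem exists_algebraMap_int_eq (hσ : σ ≠ 1) {x : 𝓞 L} (h : conj σ x = x) :
    ∃ a : 𝓞 K, algebraMap (𝓞 K) (𝓞 L) a = x := by
  obtain ⟨a, ha⟩ := exists_algebraMap_eq hσ (congrArg (algebraMap (𝓞 L) L) h)
  have hi : IsIntegral ℤ (algebraMap K L a) := ha ▸ x.2
  refine ⟨⟨a, (isIntegral_algebraMap_iff (algebraMap K L).injective).1 hi⟩, RingOfIntegers.ext ha⟩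

theorem exists_algebraMap_eq_mul_conj (hσ : σ ≠ 1) (x : 𝓞 L) :
    ∃ a : 𝓞 K, algebraMap (𝓞 K) (𝓞 L) a = x * conj σ x :=
  exists_algebraMap_int_eq hσ (by rw [map_mul, conj_conj hσ, mul_comm])

theorem mem_map_conj (hσ : σ ≠ 1) {I : Ideal (𝓞 L)} {x : 𝓞 L} :
    x ∈ I.map (conj σ) ↔ conj σ x ∈ I := by
  rw [Ideal.mem_map_of_equiv]
  constructor
  · rintro ⟨y, hy, rfl⟩
    rwa [conj_conj hσ]
  · exact fun h => ⟨_, h, conj_conj hσ x⟩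

theorem map_conj_map_conj (hσ : σ ≠ 1) (I : Ideal (𝓞 L)) : (I.map (conj σ)).map (conj σ) = I := by
  ext x
  rw [mem_map_conj hσ, mem_map_conj hσ, conj_conj hσ]

theorem map_conj_map (I : Ideal (𝓞 K)) :
    (I.map (algebraMap (𝓞 K) (𝓞 L))).map (conj σ) = I.map (algebraMap (𝓞 K) (𝓞 L)) := by
  have h : (conj σ : 𝓞 L →+* 𝓞 L).comp (algebraMap (𝓞 K) (𝓞 L)) = algebraMap (𝓞 K) (𝓞 L) :=
    RingHom.ext fun x => (conj σ).commutes x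
  conv_rhs => rw [← h]
  exact Ideal.map_map _ _

theorem finrank_int : Module.finrank (𝓞 K) (𝓞 L) = 2 := by
  rw [← IsFractionRing.finrank_eq (𝓞 K) K (𝓞 L) L, Algebra.IsQuadraticExtension.finrank_eq_two]

theorem relNorm_map_int (I : Ideal (𝓞 K)) :
    Ideal.relNorm (𝓞 K) (I.map (algebraMap (𝓞 K) (𝓞 L))) = I ^ 2 := by
  rw [Ideal.relNorm_algebraMap, finrank_int]

theorem exists_relNorm_eq_pow {P : Ideal (𝓞 L)} [hP : P.IsPrime] :
    ∃ k ≠ 0, Ideal.relNorm (𝓞 K) P = (P.under (𝓞 K)) ^ k := by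
  obtain ⟨k, hk⟩ := Ideal.exists_relNorm_eq_pow_of_isPrime P (P.under (𝓞 K))
  refine ⟨k, ?_, hk⟩
  rintro rfl
  have h := Ideal.relNorm_le_comap (𝓞 K) P
  rw [hk, pow_zero, Ideal.one_eq_top, top_le_iff, Ideal.comap_eq_top_iff] at h
  exact hP.ne_top h

theorem eq_top_of_relNorm_eq_top {I : Ideal (𝓞 L)} (h : Ideal.relNorm (𝓞 K) I = ⊤) : I = ⊤ := by
  have h' := Ideal.relNorm_le_comap (𝓞 K) I
  rwa [h, top_le_iff, Ideal.comap_eq_top_iff] at h'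

theorem under_ne_bot {P : Ideal (𝓞 L)} (hP0 : P ≠ ⊥) : P.under (𝓞 K) ≠ ⊥ := by
  intro h
  exact hP0 (Ideal.eq_bot_of_comap_eq_bot h)

theorem map_under_ne_bot {P : Ideal (𝓞 L)} (hP0 : P ≠ ⊥) :
    (P.under (𝓞 K)).map (algebraMap (𝓞 K) (𝓞 L)) ≠ ⊥ := by
  rw [Ne, Ideal.map_eq_bot_iff_of_injective (FaithfulSMul.algebraMap_injective _ _)]
  exact under_ne_bot hP0

theorem mul_map_conj_of_ne {P : Ideal (𝓞 L)} [hP : P.IsPrime] (hP0 : P ≠ ⊥)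
    (h : P.map (conj σ) ≠ P) :
    P * P.map (conj σ) = (P.under (𝓞 K)).map (algebraMap (𝓞 K) (𝓞 L)) := by
  have hp : P ∣ (P.under (𝓞 K)).map (algebraMap (𝓞 K) (𝓞 L)) :=
    Ideal.dvd_iff_le.2 Ideal.map_comap_le
  obtain ⟨A, hA⟩ := hp
  have hPp := Ideal.prime_of_isPrime hP0 hP
  have hP' : (P.map (conj σ)).IsPrime := Ideal.map_isPrime_of_equiv _
  have hP'0 : P.map (conj σ) ≠ ⊥ := by
    rwa [Ne, Ideal.map_eq_bot_iff_of_injective (conj σ).injective]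
  have h1 : P.map (conj σ) ∣ P * A := by
    rw [← hA, ← map_conj_map]
    exact Ideal.dvd_iff_le.2 (Ideal.map_mono Ideal.map_comap_le)
  have h2 : P.map (conj σ) ∣ A := by
    refine ((Ideal.prime_of_isPrime hP'0 hP').dvd_or_dvd h1).resolve_left fun h3 => h ?_
    exact ((Ideal.IsPrime.isMaximal hP hP0).eq_of_le hP'.ne_top (Ideal.dvd_iff_le.1 h3)).symm
  obtain ⟨B, rfl⟩ := h2
  rw [hA, ← mul_assoc]
  have hN := congrArg (Ideal.relNorm (𝓞 K)) hA
  obtain ⟨k, hk0, hk⟩ := exists_relNorm_eq_pow (K := K) (P := P)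
  rw [relNorm_map_int, map_mul, map_mul, Ideal.relNorm_map_algEquiv, hk, ← mul_assoc, ← pow_add] at hN
  have hne : P.under (𝓞 K) ^ 2 ≠ 0 := pow_ne_zero _ (under_ne_bot hP0)
  obtain ⟨c, hc⟩ : ∃ c, k + k = 2 + c := ⟨k + k - 2, by omega⟩
  have hB : Ideal.relNorm (𝓞 K) B = ⊤ := by
    rw [hc, pow_add, mul_assoc] at hN
    have := mul_left_cancel₀ hne ((mul_one _).trans hN)
    exact Ideal.isUnit_iff.1 (IsUnit.of_mul_eq_one_right _ this.symm)
  rw [eq_top_of_relNorm_eq_top hB, Ideal.mul_top]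

theorem eq_of_under_eq (hσ : σ ≠ 1) {P Q : Ideal (𝓞 L)} [hP : P.IsPrime] [hQ : Q.IsPrime]
    (hQ0 : Q ≠ ⊥) (h : Q.under (𝓞 K) = P.under (𝓞 K)) : Q = P ∨ Q = P.map (conj σ) := by
  by_contra! hne
  have hPm : P.IsMaximal := by
    refine hP.isMaximal fun h0 => under_ne_bot (K := K) hQ0 ?_
    rw [h, h0]
    exact Ideal.comap_bot_of_injective _ (FaithfulSMul.algebraMap_injective _ _)
  have hP'm : (P.map (conj σ)).IsMaximal := Ideal.map_isMaximal_of_equiv _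
  have hQm := hQ.isMaximal hQ0
  have h2 : ¬ (Q : Set (𝓞 L)) ⊆ ⋃ i ∈ ({P, P.map (conj σ)} : Finset (Ideal (𝓞 L))), (i : Set (𝓞 L)) := by
    intro h3
    obtain ⟨I, hI, hI'⟩ := (Ideal.subset_union_prime (s := {P, P.map (conj σ)}) P P (by
      intro i hi _ _
      simp only [Finset.mem_insert, Finset.mem_singleton] at hi
      rcases hi with rfl | rfl
      · exact hP
      · exact hP'm.isPrime)).1 h3
    simp only [Finset.mem_insert, Finset.mem_singleton] at hI
    rcases hI with rfl | rfl
    · exact hne.1 (hQm.eq_of_le hP.ne_top hI')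
    · exact hne.2 (hQm.eq_of_le hP'm.ne_top hI')
  rw [Set.not_subset] at h2
  obtain ⟨x, hxQ, hx⟩ := h2
  simp only [Finset.mem_insert, Finset.mem_singleton, Set.iUnion_iUnion_eq_or_left, Set.iUnion_iUnion_eq_left,
    Set.mem_union, SetLike.mem_coe, not_or, mem_map_conj hσ] at hx
  obtain ⟨a, ha⟩ := exists_algebraMap_eq_mul_conj hσ x
  have haQ : a ∈ Q.under (𝓞 K) := by
    rw [Ideal.mem_comap, ha]
    exact Q.mul_mem_right _ hxQ
  rw [h, Ideal.mem_comap, ha] at haQ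
  rcases hP.mem_or_mem haQ with h3 | h3
  · exact hx.1 h3
  · exact hx.2 h3

theorem inert_or_ramified (hσ : σ ≠ 1) {P : Ideal (𝓞 L)} [hP : P.IsPrime] (hP0 : P ≠ ⊥)
    (h : P.map (conj σ) = P) :
    P = (P.under (𝓞 K)).map (algebraMap (𝓞 K) (𝓞 L)) ∨
      P ^ 2 = (P.under (𝓞 K)).map (algebraMap (𝓞 K) (𝓞 L)) := by
  have hp : P ∣ (P.under (𝓞 K)).map (algebraMap (𝓞 K) (𝓞 L)) :=
    Ideal.dvd_iff_le.2 Ideal.map_comap_le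
  obtain ⟨A, hA⟩ := hp
  have hPp := Ideal.prime_of_isPrime hP0 hP
  obtain ⟨k, hk0, hk⟩ := exists_relNorm_eq_pow (K := K) (P := P)
  have hne : ∀ n, P.under (𝓞 K) ^ n ≠ 0 := fun n => pow_ne_zero _ (under_ne_bot hP0)
  have hpp : ¬ IsUnit (P.under (𝓞 K)) := by
    rw [Ideal.isUnit_iff]
    exact Ideal.comap_ne_top _ hP.ne_top
  have hN := congrArg (Ideal.relNorm (𝓞 K)) hA
  rw [relNorm_map_int, map_mul, hk] at hN
  by_cases hAt : A = ⊤
  · left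
    rw [hA, hAt, Ideal.mul_top]
  obtain ⟨Q, hQm, hQA⟩ := Ideal.exists_le_maximal A hAt
  have hQu : Q.under (𝓞 K) = P.under (𝓞 K) := by
    have hPu : (P.under (𝓞 K)).IsMaximal := Ideal.IsPrime.isMaximal inferInstance (under_ne_bot hP0)
    refine (hPu.eq_of_le (Ideal.comap_ne_top _ hQm.ne_top) ?_).symm
    rw [Ideal.under, ← Ideal.map_le_iff_le_comap, hA]
    exact Ideal.mul_le_right.trans hQA
  have hQ0 : Q ≠ ⊥ := by
    intro h0
    have := under_ne_bot (K := K) hP0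
    rw [← hQu, h0] at this
    exact this (Ideal.comap_bot_of_injective _ (FaithfulSMul.algebraMap_injective _ _))
  have hQP : Q = P := by
    have := hQm.isPrime
    rcases eq_of_under_eq hσ hQ0 hQu with h1 | h1
    · exact h1
    · rw [h1, h]
  obtain ⟨B, rfl⟩ : P ∣ A := hQP ▸ Ideal.dvd_iff_le.2 hQA
  right
  rw [map_mul, hk, ← mul_assoc, ← pow_add] at hN
  obtain ⟨c, hc⟩ : ∃ c, k + k = 2 + c := ⟨k + k - 2, by omega⟩
  have hB : Ideal.relNorm (𝓞 K) B = ⊤ := by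
    rw [hc, pow_add, mul_assoc] at hN
    have := mul_left_cancel₀ (hne 2) ((mul_one _).trans hN)
    exact Ideal.isUnit_iff.1 (IsUnit.of_mul_eq_one_right _ this.symm)
  rw [hA, eq_top_of_relNorm_eq_top hB, Ideal.mul_top, pow_two]

end Quadratic

open FractionalIdeal IsDedekindDomain
open scoped nonZeroDivisors

section Fractional

variable {K L : Type*} [Field K] [NumberField K] [Field L] [NumberField L] [Algebra K L]
  [Algebra.IsQuadraticExtension K L] {σ : L ≃ₐ[K] L}

/-- The action of an automorphism on fractional ideals. -/
noncomputable def fracConj (σ : L ≃ₐ[K] L) :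
    FractionalIdeal (𝓞 L)⁰ L →+* FractionalIdeal (𝓞 L)⁰ L :=
  extendedHom' (f := ((conj σ : 𝓞 L ≃ₐ[𝓞 K] 𝓞 L) : 𝓞 L →+* 𝓞 L)) L
    (nonZeroDivisors_le_comap_nonZeroDivisors_of_injective _ (conj σ).injective)

theorem fracConj_coeIdeal (I : Ideal (𝓞 L)) :
    fracConj σ (I : FractionalIdeal (𝓞 L)⁰ L) = (I.map (conj σ) : Ideal (𝓞 L)) :=
  extended_coeIdeal_eq_map L _ I

theorem fracConj_spanSingleton (x : L) :
    fracConj σ (spanSingleton (𝓞 L)⁰ x) = spanSingleton (𝓞 L)⁰ (σ x) := by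
  refine (extended_spanSingleton L _ x).trans ?_
  congr 1
  obtain ⟨a, b, hb, rfl⟩ := IsFractionRing.div_surjective (A := 𝓞 L) x
  rw [map_div₀, map_div₀, IsLocalization.map_eq, IsLocalization.map_eq]
  rfl

theorem fracExt_coeIdeal (I : Ideal (𝓞 K)) :
    extendedHom L (𝓞 L) (I : FractionalIdeal (𝓞 K)⁰ K) =
      (I.map (algebraMap (𝓞 K) (𝓞 L)) : Ideal (𝓞 L)) := extendedHom_coeIdeal_eq_map L (𝓞 L) I

theorem fracExt_spanSingleton (x : K) :
    extendedHom L (𝓞 L) (spanSingleton (𝓞 K)⁰ x) =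
      spanSingleton (𝓞 L)⁰ (algebraMap K L x) := by
  rw [extendedHom_spanSingleton]
  congr 1
  obtain ⟨a, b, hb, rfl⟩ := IsFractionRing.div_surjective (A := 𝓞 K) x
  rw [map_div₀, map_div₀, IsFractionRing.map, IsLocalization.map_eq, IsLocalization.map_eq]
  rfl

theorem exists_mul_eq_coeIdeal (hσ : σ ≠ 1) (I : FractionalIdeal (𝓞 L)⁰ L) :
    ∃ (a : 𝓞 K) (A : Ideal (𝓞 L)), a ≠ 0 ∧
      I * spanSingleton (𝓞 L)⁰ (algebraMap K L a) = A := by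
  obtain ⟨x, A, hx, hI⟩ := exists_eq_spanSingleton_mul I
  obtain ⟨a, ha⟩ := exists_algebraMap_eq_mul_conj hσ x
  have hxL : (algebraMap (𝓞 L) L x) ≠ 0 := by simpa using hx
  refine ⟨a, Ideal.span {conj σ x} * A, ?_, ?_⟩
  · rintro rfl
    rw [map_zero, eq_comm, mul_eq_zero] at ha
    rcases ha with h | h
    · exact hx h
    · exact hx (by simpa using h)
  · have : algebraMap K L a = algebraMap (𝓞 L) L x * algebraMap (𝓞 L) L (conj σ x) := by
      rw [← map_mul, ← ha]; rfl
    rw [hI, this, coeIdeal_mul, coeIdeal_span_singleton, mul_right_comm, spanSingleton_mul_spanSingleton,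
      inv_mul_cancel_left₀ hxL]

theorem exists_mul_eq_coeIdeal' (I : FractionalIdeal (𝓞 K)⁰ K) :
    ∃ (a : 𝓞 K) (A : Ideal (𝓞 K)), a ≠ 0 ∧
      I * spanSingleton (𝓞 K)⁰ (algebraMap (𝓞 K) K a) = A := by
  obtain ⟨x, A, hx, hI⟩ := exists_eq_spanSingleton_mul I
  have hxK : (algebraMap (𝓞 K) K x) ≠ 0 := by simpa using hx
  refine ⟨x, A, hx, ?_⟩
  rw [hI, mul_right_comm, spanSingleton_mul_spanSingleton, inv_mul_cancel₀ hxK, spanSingleton_one, one_mul]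

theorem spanSingleton_int_ne_zero {a : 𝓞 K} (ha : a ≠ 0) :
    spanSingleton (𝓞 L)⁰ (algebraMap K L a) ≠ 0 := by
  rw [spanSingleton_ne_zero_iff]
  simpa using ha

theorem fracConj_fracConj (hσ : σ ≠ 1) (I : FractionalIdeal (𝓞 L)⁰ L) :
    fracConj σ (fracConj σ I) = I := by
  obtain ⟨a, A, ha, h⟩ := exists_mul_eq_coeIdeal hσ I
  have h2 := congrArg (fun x => fracConj σ (fracConj σ x)) h
  simp only [map_mul, fracConj_spanSingleton, fracConj_coeIdeal, map_conj_map_conj hσ,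
    AlgEquiv.commutes] at h2
  rw [← h] at h2
  exact mul_right_cancel₀ (spanSingleton_int_ne_zero ha) h2

theorem fracConj_fracExt (I : FractionalIdeal (𝓞 K)⁰ K) :
    fracConj σ (extendedHom L (𝓞 L) I) = extendedHom L (𝓞 L) I := by
  obtain ⟨a, A, ha, h⟩ := exists_mul_eq_coeIdeal' I
  have h1 := congrArg (extendedHom L (𝓞 L)) h
  rw [map_mul, fracExt_spanSingleton, fracExt_coeIdeal] at h1
  have h2 := congrArg (fracConj σ) h1
  rw [map_mul, fracConj_spanSingleton, fracConj_coeIdeal, map_conj_map, AlgEquiv.commutes, ← h1] at h2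
  exact mul_right_cancel₀ (spanSingleton_int_ne_zero ha) h2

/-- The primes of `L` whose square is extended from `K`. -/
def ramified (K L : Type*) [Field K] [NumberField K] [Field L] [NumberField L] [Algebra K L] :
    Set (HeightOneSpectrum (𝓞 L)) :=
  {v | v.asIdeal ^ 2 = (v.asIdeal.under (𝓞 K)).map (algebraMap (𝓞 K) (𝓞 L))}

theorem exists_sub_mem_of_ramified {v : HeightOneSpectrum (𝓞 L)} (hv : v ∈ ramified K L)
    (x : 𝓞 L) : ∃ a : 𝓞 K, x - algebraMap (𝓞 K) (𝓞 L) a ∈ v.asIdeal := by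
  have hN := congrArg Ideal.absNorm (show _ = _ from hv)
  rw [Ideal.absNorm_algebraMap, finrank_int, map_pow] at hN
  have hN := Nat.pow_left_injective (n := 2) two_ne_zero hN
  rw [Ideal.absNorm_apply, Ideal.absNorm_apply, Submodule.cardQuot_apply, Submodule.cardQuot_apply] at hN
  have hinj : Function.Injective
      (algebraMap (𝓞 K ⧸ v.asIdeal.under (𝓞 K)) (𝓞 L ⧸ v.asIdeal)) :=
    FaithfulSMul.algebraMap_injective _ _
  have : Finite (𝓞 L ⧸ v.asIdeal) := Ideal.finiteQuotientOfFreeOfNeBot _ v.ne_bot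
  have : Finite (𝓞 K ⧸ v.asIdeal.under (𝓞 K)) := Finite.of_injective _ hinj
  have hb := (Nat.bijective_iff_injective_and_card _).2 ⟨hinj, hN.symm⟩
  obtain ⟨a, ha⟩ := hb.2 (Ideal.Quotient.mk _ x)
  obtain ⟨a, rfl⟩ := Ideal.Quotient.mk_surjective a
  refine ⟨a, ?_⟩
  rw [← Ideal.Quotient.eq_zero_iff_mem, map_sub, sub_eq_zero, ← ha]
  rfl

theorem map_conj_of_ramified {v : HeightOneSpectrum (𝓞 L)} (hv : v ∈ ramified K L) :
    v.asIdeal.map (conj σ) = v.asIdeal := by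
  have h := congrArg (Ideal.map (conj σ)) (show _ = _ from hv)
  rw [map_conj_map, Ideal.map_pow, ← show _ = _ from hv] at h
  exact (pow_left_injective two_ne_zero) h

theorem conj_sub_mem_of_ramified {v : HeightOneSpectrum (𝓞 L)} (hσ : σ ≠ 1) (hv : v ∈ ramified K L)
    (x : 𝓞 L) : conj σ x - x ∈ v.asIdeal := by
  obtain ⟨a, ha⟩ := exists_sub_mem_of_ramified hv x
  have h2 : conj σ (x - algebraMap (𝓞 K) (𝓞 L) a) ∈ v.asIdeal := by
    rwa [← mem_map_conj hσ, map_conj_of_ramified hv]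
  rw [map_sub, AlgEquiv.commutes] at h2
  simpa using v.asIdeal.sub_mem h2 ha

theorem exists_conj_ne (hσ : σ ≠ 1) : ∃ x : 𝓞 L, conj σ x ≠ x := by
  by_contra! h
  refine hσ (AlgEquiv.ext fun x => ?_)
  obtain ⟨a, b, hb, rfl⟩ := IsFractionRing.div_surjective (A := 𝓞 L) x
  rw [map_div₀, ← coe_conj, ← coe_conj, h, h]
  rfl

theorem finite_ramified : (ramified K L).Finite := by
  have : Nontrivial (L ≃ₐ[K] L) := by
    rw [← Finite.one_lt_card_iff_nontrivial, IsGalois.card_aut_eq_finrank,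
      Algebra.IsQuadraticExtension.finrank_eq_two]
    exact one_lt_two
  obtain ⟨σ, hσ⟩ := exists_ne (1 : L ≃ₐ[K] L)
  obtain ⟨x, hx⟩ := exists_conj_ne hσ
  refine (Ideal.finite_factors (I := Ideal.span {conj σ x - x}) ?_).subset fun v hv => ?_
  · simpa [sub_eq_zero] using hx
  · exact Ideal.dvd_span_singleton.2 (conj_sub_mem_of_ramified hσ hv x)

end Fractional

section Genus

variable {K L : Type*} [Field K] [NumberField K] [Field L] [NumberField L] [Algebra K L]
  [Algebra.IsQuadraticExtension K L] {σ : L ≃ₐ[K] L}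

theorem dvd_of_count_ne_zero {v : HeightOneSpectrum (𝓞 L)} {I : Ideal (𝓞 L)} (hI : I ≠ 0)
    (h : count L v I ≠ 0) : v.asIdeal ∣ I := by
  rw [count_coe L v hI] at h
  exact (Associates.count_ne_zero_iff_dvd hI v.irreducible).1 (by exact_mod_cast h)

theorem map_int_ne_zero {I : Ideal (𝓞 K)} (hI : I ≠ 0) :
    I.map (algebraMap (𝓞 K) (𝓞 L)) ≠ 0 := by
  rwa [Ne, Ideal.zero_eq_bot, Ideal.map_eq_bot_iff_of_injective (FaithfulSMul.algebraMap_injective _ _)]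

theorem even_count_map {v : HeightOneSpectrum (𝓞 L)} (hv : v ∈ ramified K L) (I : Ideal (𝓞 K)) :
    Even (count L v (I.map (algebraMap (𝓞 K) (𝓞 L)) : Ideal (𝓞 L))) := by
  induction I using UniqueFactorizationMonoid.induction_on_prime with
  | h₁ => simp [Ideal.map_bot, count_zero]
  | h₂ x hx =>
    rw [Ideal.isUnit_iff.1 hx, Ideal.map_top, coeIdeal_top, count_one]
    exact Even.zero
  | h₃ a p ha hp ih =>
    rw [Ideal.map_mul, coeIdeal_mul, count_mul _ _ (by simpa using map_int_ne_zero hp.ne_zero)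
      (by simpa using map_int_ne_zero ha)]
    refine Even.add ?_ ih
    by_cases h : count L v (p.map (algebraMap (𝓞 K) (𝓞 L)) : Ideal (𝓞 L)) = 0
    · rw [h]; exact Even.zero
    · have h1 := dvd_of_count_ne_zero (map_int_ne_zero hp.ne_zero) h
      rw [Ideal.dvd_iff_le, Ideal.map_le_iff_le_comap] at h1
      have hpm : p.IsMaximal := (Ideal.isPrime_of_prime hp).isMaximal hp.ne_zero
      have h2 : p = v.asIdeal.under (𝓞 K) := hpm.eq_of_le (Ideal.comap_ne_top _ v.isPrime.ne_top) h1
      rw [h2, ← show _ = _ from hv, coeIdeal_pow, count_pow, count_self]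
      exact ⟨1, rfl⟩

theorem prime_dvd_induction {P : Ideal (𝓞 L) → Prop} (htop : P ⊤)
    (h : ∀ (v : HeightOneSpectrum (𝓞 L)) (A : Ideal (𝓞 L)), A ≠ ⊥ → v.asIdeal ∣ A →
      (∀ B C, A = C * B → C ≠ ⊤ → P B) → P A)
    (A : Ideal (𝓞 L)) (hA : A ≠ ⊥) : P A := by
  induction A using WellFoundedGT.induction with
  | ind A ih =>
    by_cases ht : A = ⊤
    · rwa [ht]
    obtain ⟨M, hM, hAM⟩ := Ideal.exists_le_maximal A ht
    refine h ⟨M, hM.isPrime, fun h0 => hA (le_bot_iff.1 (h0 ▸ hAM))⟩ A hA (Ideal.dvd_iff_le.2 hAM) ?_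
    rintro B C rfl hC
    refine ih B (lt_of_le_of_ne Ideal.mul_le_right fun h1 => hC ?_) (right_ne_zero_of_mul hA)
    have h2 : C * B = ⊤ * B := by rw [Ideal.top_mul, h1]
    exact mul_right_cancel₀ (right_ne_zero_of_mul hA) h2

theorem exists_map_eq_of_invariant (hσ : σ ≠ 1) (A : Ideal (𝓞 L)) (hA : A ≠ ⊥)
    (h1 : A.map (conj σ) = A) (h2 : ∀ v ∈ ramified K L, Even (count L v (A : FractionalIdeal (𝓞 L)⁰ L))) :
    ∃ I : Ideal (𝓞 K), I.map (algebraMap (𝓞 K) (𝓞 L)) = A := by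
  revert h1 h2
  refine prime_dvd_induction (P := fun A => A.map (conj σ) = A →
    (∀ v ∈ ramified K L, Even (count L v (A : FractionalIdeal (𝓞 L)⁰ L))) →
    ∃ I : Ideal (𝓞 K), I.map (algebraMap (𝓞 K) (𝓞 L)) = A) (fun _ _ => ⟨⊤, Ideal.map_top _⟩) (fun v A hA hvA ih h1 h2 => ?_) A hA
  suffices hd : (v.asIdeal.under (𝓞 K)).map (algebraMap (𝓞 K) (𝓞 L)) ∣ A by
    obtain ⟨B, rfl⟩ := hd
    have h0 := map_under_ne_bot (K := K) v.ne_bot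
    have hne : (v.asIdeal.under (𝓞 K)).map (algebraMap (𝓞 K) (𝓞 L)) ≠ ⊤ := fun ht =>
      v.isPrime.ne_top (top_le_iff.1 (ht ▸ Ideal.map_comap_le))
    obtain ⟨I, rfl⟩ := ih B _ rfl hne (by
      rw [Ideal.map_mul, map_conj_map] at h1
      exact mul_left_cancel₀ h0 h1) (by
      intro w hw
      have := h2 w hw
      rw [coeIdeal_mul, count_mul _ _ (by simpa using h0) (by simpa using right_ne_zero_of_mul hA),
        Int.even_add] at this
      exact this.1 (even_count_map hw _))
    exact ⟨_ * I, Ideal.map_mul _ _ _⟩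
  by_cases hP : v.asIdeal.map (conj σ) = v.asIdeal
  · rcases inert_or_ramified hσ v.ne_bot hP with h3 | h3
    · rwa [← h3]
    · rw [← h3]
      obtain ⟨B, rfl⟩ := hvA
      have hc := h2 v h3
      have hB0 := right_ne_zero_of_mul hA
      rw [coeIdeal_mul, count_mul _ _ (by simpa using v.ne_bot) (by simpa using hB0), count_self] at hc
      rw [pow_two]
      refine mul_dvd_mul_left _ (dvd_of_count_ne_zero hB0 fun h4 => ?_)
      rw [h4] at hc
      exact absurd hc (by decide)
  · rw [← mul_map_conj_of_ne v.ne_bot hP]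
    obtain ⟨B, rfl⟩ := hvA
    refine mul_dvd_mul_left _ ?_
    have h3 : v.asIdeal.map (conj σ) ∣ v.asIdeal * B := by
      rw [← h1, Ideal.map_mul]
      exact dvd_mul_right _ _
    have hp' : (v.asIdeal.map (conj σ)).IsPrime := Ideal.map_isPrime_of_equiv _
    have hp0 : v.asIdeal.map (conj σ) ≠ ⊥ := by
      rw [Ne, Ideal.map_eq_bot_iff_of_injective (conj σ).injective]
      exact v.ne_bot
    refine ((Ideal.prime_of_isPrime hp0 hp').dvd_or_dvd h3).resolve_left fun h4 => hP ?_
    exact (v.isMaximal.eq_of_le hp'.ne_top (Ideal.dvd_iff_le.1 h4)).symm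

theorem exists_map_eq_mul_conj (hσ : σ ≠ 1) (A : Ideal (𝓞 L)) :
    ∃ I : Ideal (𝓞 K), I.map (algebraMap (𝓞 K) (𝓞 L)) = A * A.map (conj σ) := by
  induction A using UniqueFactorizationMonoid.induction_on_prime with
  | h₁ => exact ⟨⊥, by simp⟩
  | h₂ x hx => exact ⟨⊤, by simp [Ideal.isUnit_iff.1 hx, Ideal.map_top]⟩
  | h₃ a p ha hp ih =>
    obtain ⟨I, hI⟩ := ih
    have := Ideal.isPrime_of_prime hp
    obtain ⟨Q, hQ⟩ : ∃ Q : Ideal (𝓞 K), Q.map (algebraMap (𝓞 K) (𝓞 L)) = p * p.map (conj σ) := by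
      by_cases hP : p.map (conj σ) = p
      · rw [hP]
        rcases inert_or_ramified hσ hp.ne_zero hP with h3 | h3
        · exact ⟨p.under (𝓞 K) * p.under (𝓞 K), by rw [Ideal.map_mul, ← h3]⟩
        · exact ⟨_, by rw [← h3, pow_two]⟩
      · exact ⟨_, (mul_map_conj_of_ne hp.ne_zero hP).symm⟩
    exact ⟨Q * I, by rw [Ideal.map_mul, Ideal.map_mul, hQ, hI, mul_mul_mul_comm]⟩

/-- The parity of the exponent of a fractional ideal at each ramified prime. -/
noncomputable def parity (K L : Type*) [Field K] [NumberField K] [Field L] [NumberField L] [Algebra K L] :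
    (FractionalIdeal (𝓞 L)⁰ L)ˣ →* (ramified K L → Multiplicative (ZMod 2)) :=
  MonoidHom.pi fun v =>
    { toFun I := Multiplicative.ofAdd ((count L v.1 (I : FractionalIdeal (𝓞 L)⁰ L) : ℤ) : ZMod 2)
      map_one' := by simp [count_one]
      map_mul' I J := by simp [count_mul _ _ I.ne_zero J.ne_zero] }

theorem mem_ker_parity {I : (FractionalIdeal (𝓞 L)⁰ L)ˣ} :
    I ∈ (parity K L).ker ↔ ∀ v ∈ ramified K L, Even (count L v (I : FractionalIdeal (𝓞 L)⁰ L)) := by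
  rw [MonoidHom.mem_ker, funext_iff, Subtype.forall]
  refine forall₂_congr fun v hv => ?_
  rw [← ZMod.intCast_eq_zero_iff_even]
  exact Iff.rfl

/-- The action of an automorphism on invertible fractional ideals. -/
noncomputable abbrev idealConj (σ : L ≃ₐ[K] L) :
    (FractionalIdeal (𝓞 L)⁰ L)ˣ →* (FractionalIdeal (𝓞 L)⁰ L)ˣ :=
  Units.map (fracConj σ)

/-- The fractional ideals of `L` extended from `K`. -/
noncomputable def extendedIdeals (K L : Type*) [Field K] [NumberField K] [Field L] [NumberField L]
    [Algebra K L] : Subgroup (FractionalIdeal (𝓞 L)⁰ L)ˣ :=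
  (Units.map ((extendedHom L (𝓞 L) : FractionalIdeal (𝓞 K)⁰ K →+* FractionalIdeal (𝓞 L)⁰ L) :
    FractionalIdeal (𝓞 K)⁰ K →* FractionalIdeal (𝓞 L)⁰ L)).range

theorem mem_extendedIdeals {I : (FractionalIdeal (𝓞 L)⁰ L)ˣ} :
    I ∈ extendedIdeals K L ↔ ∃ J : FractionalIdeal (𝓞 K)⁰ K, extendedHom L (𝓞 L) J = I := by
  constructor
  · rintro ⟨J, rfl⟩
    exact ⟨J, rfl⟩
  · rintro ⟨J, hJ⟩
    have hJ0 : J ≠ 0 := by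
      rintro rfl
      exact I.ne_zero (hJ.symm.trans (map_zero _))
    exact ⟨Units.mk0 J hJ0, Units.ext hJ⟩

theorem even_count_of_mem_extendedIdeals {I : (FractionalIdeal (𝓞 L)⁰ L)ˣ}
    (h : I ∈ extendedIdeals K L) {v : HeightOneSpectrum (𝓞 L)} (hv : v ∈ ramified K L) :
    Even (count L v (I : FractionalIdeal (𝓞 L)⁰ L)) := by
  obtain ⟨J, hJ⟩ := mem_extendedIdeals.1 h
  obtain ⟨a, A, ha, h1⟩ := exists_mul_eq_coeIdeal' J
  have h2 := congrArg (extendedHom L (𝓞 L)) h1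
  rw [map_mul, ← coeIdeal_span_singleton, fracExt_coeIdeal, fracExt_coeIdeal, hJ] at h2
  have h3 := congrArg (count L v) h2
  have h4 : Ideal.span {a} ≠ 0 := by simpa using ha
  rw [count_mul _ _ I.ne_zero (by simpa using map_int_ne_zero h4)] at h3
  have h5 := even_count_map hv A
  rw [← h3, Int.even_add] at h5
  exact h5.2 (even_count_map hv _)

theorem extendedIdeals_le_fix : extendedIdeals K L ≤ fix (idealConj σ) := by
  intro I hI
  obtain ⟨J, hJ⟩ := mem_extendedIdeals.1 hI
  refine mem_fix.2 (Units.ext ?_)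
  rw [Units.coe_map, ← hJ]
  exact fracConj_fracExt J

theorem spanSingleton_mem_extendedIdeals {I : (FractionalIdeal (𝓞 L)⁰ L)ˣ} {a : K}
    (h : spanSingleton _ (algebraMap K L a) = (I : FractionalIdeal (𝓞 L)⁰ L)) : I ∈ extendedIdeals K L :=
  mem_extendedIdeals.2 ⟨spanSingleton _ a, (fracExt_spanSingleton a).trans h⟩

theorem mem_extendedIdeals_of_mul {I : (FractionalIdeal (𝓞 L)⁰ L)ˣ} {a : K} (ha : a ≠ 0)
    {A : Ideal (𝓞 K)} (h : (I : FractionalIdeal (𝓞 L)⁰ L) * spanSingleton _ (algebraMap K L a) =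
      ((A.map (algebraMap (𝓞 K) (𝓞 L)) : Ideal (𝓞 L)) : FractionalIdeal (𝓞 L)⁰ L)) :
    I ∈ extendedIdeals K L := by
  refine mem_extendedIdeals.2 ⟨(A : FractionalIdeal (𝓞 K)⁰ K) * spanSingleton _ a⁻¹, ?_⟩
  rw [map_mul, fracExt_coeIdeal, fracExt_spanSingleton, ← h, mul_assoc, spanSingleton_mul_spanSingleton,
    ← map_mul, mul_inv_cancel₀ ha, map_one, spanSingleton_one, mul_one]

theorem fix_inf_ker_parity (hσ : σ ≠ 1) :
    (parity K L).ker ⊓ fix (idealConj σ) = extendedIdeals K L := by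
  refine le_antisymm (fun I ⟨h1, h2⟩ => ?_) (le_inf (fun I hI => mem_ker_parity.2 fun v hv =>
    even_count_of_mem_extendedIdeals hI hv) extendedIdeals_le_fix)
  obtain ⟨a, A, ha, hA⟩ := exists_mul_eq_coeIdeal hσ (I : FractionalIdeal (𝓞 L)⁰ L)
  have haL := spanSingleton_int_ne_zero (K := K) (L := L) ha
  have haK : (a : K) ≠ 0 := by simpa using ha
  have hA0 : A ≠ ⊥ := by
    rintro rfl
    rw [coeIdeal_bot] at hA
    exact mul_ne_zero I.ne_zero haL hA
  have hI : fracConj σ I = I := congrArg Units.val (mem_fix.1 h2)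
  obtain ⟨B, rfl⟩ := exists_map_eq_of_invariant hσ A hA0 (by
    have := congrArg (fracConj σ) hA
    rw [map_mul, hI, fracConj_spanSingleton, AlgEquiv.commutes, hA, fracConj_coeIdeal, coeIdeal_inj] at this
    exact this.symm) (by
    intro v hv
    rw [← hA, count_mul _ _ I.ne_zero haL]
    refine (mem_ker_parity.1 h1 v hv).add ?_
    exact even_count_of_mem_extendedIdeals (I := Units.mk0 _ haL)
      (spanSingleton_mem_extendedIdeals rfl) hv)
  exact mem_extendedIdeals_of_mul haK hA

theorem map_parity_fix : (fix (idealConj σ)).map (parity K L) = ⊤ := by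
  classical
  rw [eq_top_iff]
  intro f _
  have : Finite (ramified K L) := finite_ramified
  have : Fintype (ramified K L) := Fintype.ofFinite _
  have hv0 : ∀ v : ramified K L, (v.1.asIdeal : FractionalIdeal (𝓞 L)⁰ L) ≠ 0 := fun v => by
    simpa using v.1.ne_bot
  have key : ∀ v : ramified K L, parity K L (Units.mk0 _ (hv0 v)) = Pi.mulSingle v (Multiplicative.ofAdd 1) := by
    intro v
    funext w
    change Multiplicative.ofAdd ((count L w.1 (v.1.asIdeal : FractionalIdeal (𝓞 L)⁰ L) : ℤ) : ZMod 2) = _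
    rw [count_maximal]
    by_cases h : w = v
    · subst h; simp
    · rw [if_neg (fun h' => h (Subtype.ext h'.symm)), Pi.mulSingle_eq_of_ne h]; simp
  refine ⟨∏ v, (Units.mk0 _ (hv0 v)) ^ (f v).toAdd.val, ?_, ?_⟩
  · refine Subgroup.prod_mem _ fun v _ => Subgroup.pow_mem _ (mem_fix.2 (Units.ext ?_)) _
    exact (fracConj_coeIdeal _).trans (by rw [map_conj_of_ramified v.2]; rfl)
  · rw [map_prod]
    simp_rw [map_pow, key]
    conv_rhs => rw [← Finset.univ_prod_mulSingle f]
    refine Finset.prod_congr rfl fun v _ => ?_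
    rw [← Pi.mulSingle_pow]
    congr 1
    rw [← ofAdd_nsmul, nsmul_one, ZMod.natCast_val, ZMod.cast_id', id, ofAdd_toAdd]

theorem relIndex_extendedIdeals (hσ : σ ≠ 1) :
    (extendedIdeals K L).relIndex (fix (idealConj σ)) = 2 ^ (ramified K L).ncard := by
  have : Finite (ramified K L) := finite_ramified
  rw [← fix_inf_ker_parity hσ, Subgroup.inf_relIndex_right, ← MonoidHom.comap_bot, Subgroup.relIndex_comap,
    map_parity_fix, Subgroup.relIndex_top_right, Subgroup.index_bot, Nat.card_fun, Nat.card_coe_set_eq,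
    Nat.card_congr Multiplicative.toAdd, Nat.card_zmod]

end Genus

section UnitRank

variable {F : Type*} [Field F] [NumberField F]

theorem two_mul_rank_add_one {i : F} (hi : i ^ 2 = -1) :
    2 * (Units.rank F + 1) = Module.finrank ℚ F := by
  have hr : InfinitePlace.nrRealPlaces F = 0 := by
    classical
    rw [InfinitePlace.nrRealPlaces, Fintype.card_eq_zero_iff]
    refine ⟨fun ⟨w, hw⟩ => ?_⟩
    rw [InfinitePlace.isReal_iff] at hw
    have h1 := congrArg hw.embedding hi
    rw [map_pow, map_neg, map_one] at h1
    nlinarith [sq_nonneg (hw.embedding i)]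
  rw [← InfinitePlace.card_add_two_mul_card_eq_rank, Units.rank,
    InfinitePlace.card_eq_nrRealPlaces_add_nrComplexPlaces, hr]
  have : 0 < Fintype.card (InfinitePlace F) := Fintype.card_pos
  rw [InfinitePlace.card_eq_nrRealPlaces_add_nrComplexPlaces, hr] at this
  omega

theorem exists_unit_eq {i : F} (hi : i ^ 2 = -1) : ∃ e : (𝓞 F)ˣ, ((e : 𝓞 F) : F) = i := by
  have hiI : IsIntegral ℤ i := IsIntegral.of_pow (n := 2) two_pos (hi ▸ isIntegral_one.neg)
  refine ⟨Units.mkOfMulEqOne ⟨i, hiI⟩ (-⟨i, hiI⟩) (RingOfIntegers.ext ?_), rfl⟩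
  change i * -i = 1
  rw [mul_neg, ← pow_two, hi, neg_neg]

end UnitRank

section ClassGroup

/-- The index of the subgroup of squares in the class group. -/
noncomputable def sqIndex (F : Type*) [Field F] [NumberField F] : ℕ :=
  (powMonoidHom 2 : ClassGroup (𝓞 F) →* ClassGroup (𝓞 F)).range.index

variable {F : Type*} [Field F] [NumberField F]

theorem card_ker_sq_eq_sqIndex :
    Nat.card (powMonoidHom 2 : ClassGroup (𝓞 F) →* ClassGroup (𝓞 F)).ker = sqIndex F := by
  have h1 := Subgroup.index_mul_card (powMonoidHom 2 : ClassGroup (𝓞 F) →* ClassGroup (𝓞 F)).ker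
  have h2 := Subgroup.index_mul_card (powMonoidHom 2 : ClassGroup (𝓞 F) →* ClassGroup (𝓞 F)).range
  rw [Subgroup.index_ker, ← h2, mul_comm] at h1
  exact Nat.eq_of_mul_eq_mul_right Nat.card_pos h1

/-- The class of an invertible fractional ideal. -/
noncomputable def classHom (F : Type*) [Field F] [NumberField F] :
    (FractionalIdeal (𝓞 F)⁰ F)ˣ →* ClassGroup (𝓞 F) :=
  ((ClassGroup.equiv (R := 𝓞 F) F).symm.toMonoidHom).comp
    (QuotientGroup.mk' (toPrincipalIdeal (𝓞 F) F).range)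

theorem classHom_surjective : Function.Surjective (classHom F) :=
  (ClassGroup.equiv (R := 𝓞 F) F).symm.surjective.comp (QuotientGroup.mk'_surjective _)

theorem ker_classHom : (classHom F).ker = (toPrincipalIdeal (𝓞 F) F).range := by
  ext I
  simp [classHom]

theorem pow_card_mem_range (I : (FractionalIdeal (𝓞 F)⁰ F)ˣ) :
    I ^ Nat.card (ClassGroup (𝓞 F)) ∈ (toPrincipalIdeal (𝓞 F) F).range := by
  rw [← ker_classHom, MonoidHom.mem_ker, map_pow, pow_card_eq_one']

theorem relIndex_range_toPrincipalIdeal :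
    (toPrincipalIdeal (𝓞 F) F).range.relIndex
      ((toPrincipalIdeal (𝓞 F) F).range.comap (powMonoidHom 2)) = sqIndex F := by
  rw [← card_ker_sq_eq_sqIndex, ← ker_classHom, ← MonoidHom.comap_bot, Subgroup.relIndex_comap,
    Subgroup.relIndex_bot_left]
  congr 2
  ext c
  obtain ⟨I, rfl⟩ := classHom_surjective c
  constructor
  · rintro ⟨J, hJ, hJI⟩
    rw [← hJI]
    simpa [MonoidHom.mem_ker] using hJ
  · intro h
    exact ⟨I, by simpa [MonoidHom.mem_ker] using h, rfl⟩

/-- The embedding of the units of the ring of integers. -/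
noncomputable abbrev unitHom (F : Type*) [Field F] [NumberField F] : (𝓞 F)ˣ →* Fˣ :=
  Units.map (algebraMap (𝓞 F) F)

theorem unitHom_injective : Function.Injective (unitHom F) :=
  Units.map_injective (RingOfIntegers.coe_injective)

theorem ker_toPrincipalIdeal : (toPrincipalIdeal (𝓞 F) F).ker = (unitHom F).range := by
  ext x
  rw [MonoidHom.mem_ker, toPrincipalIdeal_eq_iff, Units.val_one]
  constructor
  · intro h
    have h' : spanSingleton (𝓞 F)⁰ ((x⁻¹ : Fˣ) : F) = 1 := by
      rw [Units.val_inv_eq_inv_val, ← spanSingleton_inv, h, inv_one]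
    obtain ⟨a, ha⟩ := (mem_one_iff _).1 (h ▸ mem_spanSingleton_self (𝓞 F)⁰ (x : F))
    obtain ⟨b, hb⟩ := (mem_one_iff _).1 (h' ▸ mem_spanSingleton_self (𝓞 F)⁰ ((x⁻¹ : Fˣ) : F))
    have hab : a * b = 1 := RingOfIntegers.ext (by
      change algebraMap (𝓞 F) F (a * b) = algebraMap (𝓞 F) F 1
      rw [map_mul, ha, hb, map_one, Units.mul_inv])
    exact ⟨Units.mkOfMulEqOne a b hab, Units.ext ha⟩
  · rintro ⟨u, rfl⟩
    have h : spanSingleton (𝓞 F)⁰ ((unitHom F u : Fˣ) : F) = (Ideal.span {(u : 𝓞 F)} : Ideal (𝓞 F)) :=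
      (coeIdeal_span_singleton _).symm
    rw [h, Ideal.span_singleton_eq_top.2 u.isUnit, coeIdeal_top]

theorem relIndex_sq_range_unitHom : ((unitHom F).range.map (powMonoidHom 2)).relIndex (unitHom F).range
    = 2 ^ (Units.rank F + 1) := by
  rw [← index_range_sq_units, ← Subgroup.relIndex_top_right,
    ← Subgroup.relIndex_map_map_of_injective _ _ unitHom_injective, ← MonoidHom.range_eq_map]
  congr 1
  ext x
  simp

end ClassGroup

section Formula

variable {K L : Type*} [Field K] [NumberField K] [Field L] [NumberField L] [Algebra K L]
  [Algebra.IsQuadraticExtension K L] {σ : L ≃ₐ[K] L}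

/-- The action of an automorphism on the multiplicative group. -/
noncomputable abbrev unitsConj (σ : L ≃ₐ[K] L) : Lˣ →* Lˣ := Units.map (σ : L →* L)

/-- The inclusion of the integral units of `K` in `L`. -/
noncomputable abbrev unitIncl (K L : Type*) [Field K] [NumberField K] [Field L] [Algebra K L] :
    (𝓞 K)ˣ →* Lˣ := (Units.map (algebraMap K L : K →* L)).comp (unitHom K)

theorem unitIncl_injective : Function.Injective (unitIncl K L) :=
  (Units.map_injective (algebraMap K L).injective).comp unitHom_injective

/-- The integral units of `K` that are norms from `L`. -/
noncomputable def normUnits (σ : L ≃ₐ[K] L) : Subgroup (𝓞 K)ˣ :=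
  (nm (unitsConj σ)).range.comap (unitIncl K L)

theorem mem_normUnits {u : (𝓞 K)ˣ} :
    u ∈ normUnits σ ↔ ∃ x : L, x * σ x = algebraMap K L (u : 𝓞 K) := by
  constructor
  · rintro ⟨x, hx⟩
    exact ⟨x, congrArg Units.val hx⟩
  · rintro ⟨x, hx⟩
    have hx0 : x ≠ 0 := by
      rintro rfl
      rw [zero_mul] at hx
      exact (unitIncl K L u).ne_zero hx.symm
    exact ⟨Units.mk0 x hx0, Units.ext hx⟩

theorem unitsConj_unitsConj (hσ : σ ≠ 1) (x : Lˣ) : unitsConj σ (unitsConj σ x) = x :=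
  Units.ext (aut_aut hσ x)

theorem idealConj_idealConj (hσ : σ ≠ 1) (I : (FractionalIdeal (𝓞 L)⁰ L)ˣ) :
    idealConj σ (idealConj σ I) = I :=
  Units.ext (fracConj_fracConj hσ I)

theorem toPrincipalIdeal_unitsConj (x : Lˣ) :
    toPrincipalIdeal (𝓞 L) L (unitsConj σ x) = idealConj σ (toPrincipalIdeal (𝓞 L) L x) := by
  rw [toPrincipalIdeal_eq_iff]
  change _ = fracConj σ (toPrincipalIdeal (𝓞 L) L x : FractionalIdeal (𝓞 L)⁰ L)
  rw [coe_toPrincipalIdeal, fracConj_spanSingleton]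
  rfl

theorem ker_inf_fix (hσ : σ ≠ 1) :
    (toPrincipalIdeal (𝓞 L) L).ker ⊓ fix (unitsConj σ) = (unitIncl K L).range := by
  rw [ker_toPrincipalIdeal]
  ext x
  constructor
  · rintro ⟨⟨u, rfl⟩, hu⟩
    have h1 : ∀ v : (𝓞 L)ˣ, unitsConj σ (unitHom L v) = unitHom L v →
        ∃ a : 𝓞 K, algebraMap (𝓞 K) (𝓞 L) a = v := fun v hv =>
      exists_algebraMap_int_eq hσ (RingOfIntegers.ext (congrArg Units.val hv))
    obtain ⟨a, ha⟩ := h1 u hu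
    obtain ⟨b, hb⟩ := h1 u⁻¹ (by rw [map_inv, map_inv, mem_fix.1 hu])
    have hab : a * b = 1 := FaithfulSMul.algebraMap_injective (𝓞 K) (𝓞 L) (by
      rw [map_mul, ha, hb, map_one, Units.mul_inv])
    refine ⟨Units.mkOfMulEqOne a b hab, Units.ext ?_⟩
    exact congrArg (algebraMap (𝓞 L) L) ha
  · rintro ⟨u, rfl⟩
    exact ⟨⟨Units.map (algebraMap (𝓞 K) (𝓞 L)) u, rfl⟩, Units.ext (σ.commutes _)⟩

theorem exists_df_of_nm_eq_one (hσ : σ ≠ 1) (x : Lˣ) (hx : nm (unitsConj σ) x = 1) :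
    ∃ y, x = df (unitsConj σ) y := by
  have hx' : (x : L) * σ x = 1 := congrArg Units.val hx
  by_cases h : 1 + (x : L) = 0
  · obtain ⟨z, hz⟩ := exists_conj_ne hσ
    have hz' : (z : L) - σ z ≠ 0 := fun h => hz (RingOfIntegers.ext (sub_eq_zero.1 h).symm)
    refine ⟨Units.mk0 _ hz', ?_⟩
    rw [df_apply, eq_div_iff_mul_eq']
    refine Units.ext ?_
    change (x : L) * σ (z - σ z) = z - σ z
    rw [map_sub, aut_aut hσ, eq_neg_of_add_eq_zero_right h]
    ring
  · refine ⟨Units.mk0 _ h, ?_⟩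
    rw [df_apply, eq_div_iff_mul_eq']
    refine Units.ext ?_
    change (x : L) * σ (1 + x) = 1 + x
    rw [map_add, map_one, mul_add, mul_one, hx', add_comm]

theorem exists_df_of_nm_eq_one_ideal (I : (FractionalIdeal (𝓞 L)⁰ L)ˣ)
    (hI : nm (idealConj σ) I = 1) : ∃ J, I = df (idealConj σ) J := by
  have hI' : (I : FractionalIdeal (𝓞 L)⁰ L) * fracConj σ I = 1 := congrArg Units.val hI
  have h : 1 + (I : FractionalIdeal (𝓞 L)⁰ L) ≠ 0 := fun h =>
    one_ne_zero (le_antisymm ((le_sup_left.trans (sup_eq_add _ _).le).trans h.le) (zero_le _))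
  refine ⟨Units.mk0 _ h, ?_⟩
  rw [df_apply, eq_div_iff_mul_eq']
  refine Units.ext ?_
  change (I : FractionalIdeal (𝓞 L)⁰ L) * fracConj σ (1 + I) = 1 + I
  rw [map_add, map_one, mul_add, mul_one, hI', add_comm]

theorem nm_mem_extendedIdeals (hσ : σ ≠ 1) (I : (FractionalIdeal (𝓞 L)⁰ L)ˣ) :
    nm (idealConj σ) I ∈ extendedIdeals K L := by
  obtain ⟨a, A, ha, hA⟩ := exists_mul_eq_coeIdeal hσ (I : FractionalIdeal (𝓞 L)⁰ L)
  obtain ⟨B, hB⟩ := exists_map_eq_mul_conj hσ A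
  have haK : (a : K) ≠ 0 := by simpa using ha
  refine mem_extendedIdeals_of_mul (mul_ne_zero haK haK) (A := B) ?_
  rw [hB, coeIdeal_mul, ← fracConj_coeIdeal, ← hA, map_mul (fracConj σ), fracConj_spanSingleton,
    AlgEquiv.commutes, map_mul (algebraMap K L), ← spanSingleton_mul_spanSingleton, mul_mul_mul_comm]
  rfl

theorem exists_of_mem_extendedIdeals {I : (FractionalIdeal (𝓞 L)⁰ L)ˣ}
    (hI : I ∈ extendedIdeals K L) : ∃ x ∈ fix (unitsConj σ),
      toPrincipalIdeal (𝓞 L) L x = I ^ Nat.card (ClassGroup (𝓞 K)) := by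
  obtain ⟨J, rfl⟩ := hI
  obtain ⟨a, ha⟩ := pow_card_mem_range J
  refine ⟨Units.map (algebraMap K L : K →* L) a, Units.ext (σ.commutes _), ?_⟩
  rw [← map_pow, ← ha]
  refine Units.ext ?_
  rw [Units.coe_map, coe_toPrincipalIdeal, coe_toPrincipalIdeal]
  exact (fracExt_spanSingleton _).symm

theorem genus_formula (hσ : σ ≠ 1) {i : K} (hi : i ^ 2 = -1)
    (hK : Odd (Nat.card (ClassGroup (𝓞 K)))) :
    2 * sqIndex L * (normUnits σ).index = 2 ^ (ramified K L).ncard := by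
  have h1 := ambiguous_relIndex (s := unitsConj σ) (t := idealConj σ) (δ := toPrincipalIdeal (𝓞 L) L)
    (J := extendedIdeals K L) (unitsConj_unitsConj hσ) (idealConj_idealConj hσ) toPrincipalIdeal_unitsConj
    (exists_df_of_nm_eq_one hσ) exists_df_of_nm_eq_one_ideal extendedIdeals_le_fix
    (nm_mem_extendedIdeals hσ) (fun x hx => by
      obtain ⟨a, ha⟩ := exists_algebraMap_eq hσ (congrArg Units.val (mem_fix.1 hx))
      refine spanSingleton_mem_extendedIdeals (a := a) ?_
      rw [coe_toPrincipalIdeal, ha]) hK (fun j hj => exists_of_mem_extendedIdeals hj)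
  obtain ⟨i', hi'⟩ := exists_unit_eq hi
  have hker := ker_inf_fix (K := K) (L := L) hσ
  have hmem : unitIncl K L i' ∈ (toPrincipalIdeal (𝓞 L) L).ker ⊓ fix (unitsConj σ) := hker ▸ ⟨i', rfl⟩
  obtain ⟨h2, h3⟩ := herbrand (s := unitsConj σ) (E := (toPrincipalIdeal (𝓞 L) L).ker) (m := -1)
    (i := unitIncl K L i') (ρ := Units.rank K) (unitsConj_unitsConj hσ) (fun x hx => by
      rw [MonoidHom.mem_ker] at hx ⊢
      rw [toPrincipalIdeal_unitsConj, hx, map_one]) hmem.1 hmem.2 (Units.ext (by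
        change (algebraMap K L (i' : 𝓞 K)) ^ 2 = -1
        rw [hi', ← map_pow, hi, map_neg, map_one])) (by simp) (by
        intro h
        have := congrArg Units.val h
        norm_num at this) (fun x hx => by
          rcases sq_eq_one_iff.1 (congrArg Units.val hx) with h | h
          · exact Or.inl (Units.ext h)
          · exact Or.inr (Units.ext h)) (by
        rw [ker_toPrincipalIdeal, relIndex_sq_range_unitHom]
        congr 1
        have e1 := two_mul_rank_add_one hi
        have e2 : 2 * (Units.rank L + 1) = Module.finrank ℚ L :=
          two_mul_rank_add_one (i := algebraMap K L i) (by rw [← map_pow, hi, map_neg, map_one])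
        have e3 := Module.finrank_mul_finrank ℚ K L
        rw [Algebra.IsQuadraticExtension.finrank_eq_two K L] at e3
        omega) (by
        rw [hker, ← index_range_sq_units, ← Subgroup.relIndex_top_right,
          ← Subgroup.relIndex_map_map_of_injective _ _ (unitIncl_injective (K := K) (L := L)),
          ← MonoidHom.range_eq_map]
        congr 1
        ext x
        simp)
  rw [h2, relIndex_range_toPrincipalIdeal, hker, ← Subgroup.index_comap,
    relIndex_extendedIdeals hσ] at h1
  rw [hker] at h3
  refine Nat.eq_of_mul_eq_mul_right (Nat.pos_of_ne_zero h3) ?_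
  rw [← h1, normUnits]
  ring

theorem exists_unit_mul_conj (hσ : σ ≠ 1) (hL : Odd (Nat.card (ClassGroup (𝓞 L)))) {u : (𝓞 K)ˣ}
    (hu : u ∈ normUnits σ) : ∃ v : (𝓞 L)ˣ, (v : 𝓞 L) * conj σ v = algebraMap (𝓞 K) (𝓞 L) u := by
  obtain ⟨x, hx⟩ := hu
  have hu1 : toPrincipalIdeal (𝓞 L) L (unitIncl K L u) = 1 :=
    MonoidHom.mem_ker.1 ((ker_inf_fix (K := K) hσ).ge ⟨u, rfl⟩).1
  have hσu : unitsConj σ (unitIncl K L u) = unitIncl K L u :=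
    mem_fix.1 ((ker_inf_fix (K := K) hσ).ge ⟨u, rfl⟩).2
  obtain ⟨J, hJ⟩ := exists_df_of_nm_eq_one_ideal (σ := σ) (toPrincipalIdeal (𝓞 L) L x) (by
    rw [nm_apply, ← toPrincipalIdeal_unitsConj, ← map_mul, ← nm_apply, hx, hu1])
  obtain ⟨y, hy⟩ := pow_card_mem_range J
  obtain ⟨k, hk⟩ := hL
  have h1 : x ^ (2 * k + 1) / df (unitsConj σ) y ∈ (toPrincipalIdeal (𝓞 L) L).ker := by
    rw [MonoidHom.mem_ker, map_div, map_pow, hJ, ← hk, ← map_pow, ← hy, df_apply, df_apply, map_div,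
      toPrincipalIdeal_unitsConj, div_self']
  have h2 : x ^ (2 * k + 1) / df (unitsConj σ) y / unitIncl K L u ^ k ∈ (toPrincipalIdeal (𝓞 L) L).ker :=
    div_mem h1 (pow_mem (MonoidHom.mem_ker.2 hu1) k)
  rw [ker_toPrincipalIdeal] at h2
  obtain ⟨v, hv⟩ := h2
  refine ⟨v, RingOfIntegers.ext ?_⟩
  have h3 : nm (unitsConj σ) (unitHom L v) = unitIncl K L u := by
    rw [hv, map_div, map_div, map_pow, hx, nm_df (unitsConj_unitsConj hσ), _root_.div_one, map_pow, nm_apply, hσu,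
      ← pow_two, ← pow_mul, pow_succ, mul_div_cancel_left]
  exact congrArg Units.val h3

end Formula

section Quadratic

theorem exists_isQuadraticExtension.{u} {K : Type u} [Field K] [NumberField K] {a : K}
    (ha : ¬ IsSquare a) : ∃ (M : Type u) (_ : Field M) (_ : NumberField M) (_ : Algebra K M)
      (_ : Algebra.IsQuadraticExtension K M) (x : M), x ^ 2 = algebraMap K M a := by
  have hirr : Irreducible (Polynomial.X ^ 2 - Polynomial.C a) := by
    refine X_pow_sub_C_irreducible_of_prime Nat.prime_two fun b hb => ha ⟨b, ?_⟩
    rw [← hb, pow_two]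
  have := Fact.mk hirr
  let M := AdjoinRoot (Polynomial.X ^ 2 - Polynomial.C a)
  have hne : Polynomial.X ^ 2 - Polynomial.C a ≠ 0 := hirr.ne_zero
  have h2 : Module.finrank K M = 2 := by
    rw [(AdjoinRoot.powerBasis hne).finrank, AdjoinRoot.powerBasis_dim, Polynomial.natDegree_X_pow_sub_C]
  have : CharZero M := charZero_of_injective_algebraMap (algebraMap K M).injective
  have : FiniteDimensional K M := .of_finrank_pos (two_pos.trans_eq h2.symm)
  have : IsScalarTower ℚ K M := .of_algebraMap_eq' (RingHom.ext_rat _ _)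
  have : NumberField M := { to_finiteDimensional := .trans ℚ K M }
  refine ⟨M, inferInstance, this, inferInstance, ⟨h2⟩, AdjoinRoot.root _, ?_⟩
  have h := AdjoinRoot.eval₂_root (Polynomial.X ^ 2 - Polynomial.C a)
  rwa [Polynomial.eval₂_sub, Polynomial.eval₂_pow, Polynomial.eval₂_X, Polynomial.eval₂_C,
    sub_eq_zero] at h

variable {K L : Type*} [Field K] [NumberField K] [Field L] [NumberField L] [Algebra K L]
  [Algebra.IsQuadraticExtension K L] {σ : L ≃ₐ[K] L}

variable (K L) in
theorem exists_aut_ne_one : ∃ σ : L ≃ₐ[K] L, σ ≠ 1 := by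
  have h := IsGalois.card_aut_eq_finrank K L
  rw [Algebra.IsQuadraticExtension.finrank_eq_two] at h
  obtain ⟨y, hy, -⟩ := (Nat.card_eq_two_iff' (1 : L ≃ₐ[K] L)).1 h
  exact ⟨y, hy⟩

theorem aut_eq_neg (hσ : σ ≠ 1) {a : K} (ha : ¬ IsSquare a) {x : L} (hx : x ^ 2 = algebraMap K L a) :
    σ x = -x := by
  have h : (σ x) ^ 2 = x ^ 2 := by rw [← map_pow, hx, σ.commutes]
  refine (sq_eq_sq_iff_eq_or_eq_neg.1 h).resolve_left fun h => ?_
  obtain ⟨b, rfl⟩ := exists_algebraMap_eq hσ h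
  refine ha ⟨b, (algebraMap K L).injective ?_⟩
  rw [← hx, map_mul, pow_two]

theorem exists_mul_conj_eq_iff (hσ : σ ≠ 1) {a : K} (ha : ¬ IsSquare a) {x : L}
    (hx : x ^ 2 = algebraMap K L a) (u : K) :
    (∃ z : L, z * σ z = algebraMap K L u) ↔ ∃ b c : K, b ^ 2 - a * c ^ 2 = u := by
  have hσx := aut_eq_neg hσ ha hx
  have hx0 : x ≠ 0 := by
    rintro rfl
    refine ha ⟨0, (algebraMap K L).injective ?_⟩
    rw [← hx, mul_zero, map_zero, zero_pow two_ne_zero]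
  constructor
  · rintro ⟨z, hz⟩
    obtain ⟨b, hb⟩ := exists_algebraMap_eq hσ (x := (z + σ z) / 2) (by
      rw [map_div₀, map_add, aut_aut hσ, add_comm, map_ofNat])
    obtain ⟨c, hc⟩ := exists_algebraMap_eq hσ (x := (z - σ z) / (2 * x)) (by
      rw [map_div₀, map_sub, aut_aut hσ, map_mul, map_ofNat, hσx, mul_neg, div_neg, ← neg_div, neg_sub])
    refine ⟨b, c, (algebraMap K L).injective ?_⟩
    rw [map_sub, map_pow, map_mul, map_pow, hb, hc, ← hx, ← hz]
    field_simp
    ring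
  · rintro ⟨b, c, rfl⟩
    refine ⟨algebraMap K L b + algebraMap K L c * x, ?_⟩
    rw [map_add, map_mul, AlgEquiv.commutes, AlgEquiv.commutes, hσx, map_sub, map_mul, map_pow, map_pow,
      ← hx]
    ring

theorem odd_card_of_sqIndex_eq_one (h : sqIndex K = 1) : Odd (Nat.card (ClassGroup (𝓞 K))) := by
  rw [← Nat.not_even_iff_odd, even_iff_two_dvd]
  intro h2
  rw [← card_ker_sq_eq_sqIndex, Subgroup.card_eq_one] at h
  obtain ⟨c, hc⟩ := exists_prime_orderOf_dvd_card' 2 h2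
  have : c ∈ (powMonoidHom 2 : ClassGroup (𝓞 K) →* ClassGroup (𝓞 K)).ker := by
    rw [MonoidHom.mem_ker, powMonoidHom_apply, ← hc, pow_orderOf_eq_one]
  rw [h, Subgroup.mem_bot] at this
  rw [this, orderOf_one] at hc
  norm_num at hc

theorem eq_of_mem_ramified {v w : HeightOneSpectrum (𝓞 L)} (hv : v ∈ ramified K L)
    (hw : w ∈ ramified K L) (h : v.asIdeal.under (𝓞 K) = w.asIdeal.under (𝓞 K)) : v = w := by
  have hv' : _ = _ := hv
  have hw' : _ = _ := hw
  rw [h, ← hw'] at hv'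
  exact HeightOneSpectrum.ext (pow_left_injective two_ne_zero hv')

theorem two_mul_mem_of_ramified (hσ : σ ≠ 1) {v : HeightOneSpectrum (𝓞 L)} (hv : v ∈ ramified K L)
    {x : 𝓞 L} (hx : conj σ x = -x) : 2 * x ∈ v.asIdeal := by
  have := conj_sub_mem_of_ramified hσ hv x
  rw [hx] at this
  rw [← neg_mem_iff]
  convert this using 1
  ring

theorem exists_int_of_sq {a : 𝓞 K} {x : L} (hx : x ^ 2 = algebraMap K L a) : ∃ y : 𝓞 L, (y : L) = x :=
  ⟨⟨x, IsIntegral.of_pow two_pos (hx ▸ (algebraMap (𝓞 K) (𝓞 L) a).2)⟩, rfl⟩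

theorem odd_card_and_normUnits_eq_top (hσ : σ ≠ 1) {i : K} (hi : i ^ 2 = -1)
    (hK : Odd (Nat.card (ClassGroup (𝓞 K))))
    (h2 : ∀ P Q : Ideal (𝓞 K), P.IsPrime → Q.IsPrime → 2 ∈ P → 2 ∈ Q → P = Q)
    {u : (𝓞 K)ˣ} (hu : ¬ IsSquare ((u : 𝓞 K) : K)) {x : L} (hx : x ^ 2 = algebraMap K L (u : 𝓞 K)) :
    Odd (Nat.card (ClassGroup (𝓞 L))) ∧ normUnits σ = ⊤ := by
  obtain ⟨y, rfl⟩ := exists_int_of_sq hx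
  have hy : y ^ 2 = algebraMap (𝓞 K) (𝓞 L) u := RingOfIntegers.ext hx
  have hyu : IsUnit y := by
    rw [← isUnit_pow_iff two_ne_zero, hy]
    exact u.isUnit.map _
  have h2mem : ∀ v ∈ ramified K L, 2 ∈ v.asIdeal.under (𝓞 K) := by
    intro v hv
    have := two_mul_mem_of_ramified hσ hv (x := y) (RingOfIntegers.ext (aut_eq_neg hσ hu hx))
    rw [Ideal.mul_unit_mem_iff_mem _ hyu] at this
    rwa [Ideal.mem_comap, map_ofNat]
  have ht : (ramified K L).ncard ≤ 1 := by
    rw [Set.ncard_le_one finite_ramified]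
    intro v hv w hw
    exact eq_of_mem_ramified hv hw (h2 _ _ inferInstance inferInstance (h2mem v hv) (h2mem w hw))
  have hf := genus_formula hσ hi hK
  have hf1 : sqIndex L * (normUnits σ).index = 1 := by
    rw [mul_assoc] at hf
    interval_cases (ramified K L).ncard <;> omega
  exact ⟨odd_card_of_sqIndex_eq_one (Nat.eq_one_of_mul_eq_one_right hf1),
    Subgroup.index_eq_one.1 (Nat.eq_one_of_mul_eq_one_left hf1)⟩

end Quadratic

section NormResidue

variable {K L : Type*} [Field K] [NumberField K] [Field L] [NumberField L] [Algebra K L]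
  [Algebra.IsQuadraticExtension K L] {σ : L ≃ₐ[K] L}

theorem exists_prime_under_eq {P : Ideal (𝓞 K)} (hP : P.IsPrime) :
    ∃ Q : Ideal (𝓞 L), Q.IsPrime ∧ Q.under (𝓞 K) = P := by
  obtain ⟨Q, -, hQ, hQP⟩ := Ideal.exists_ideal_over_prime_of_isIntegral P (⊥ : Ideal (𝓞 L)) (by
    rw [Ideal.comap_bot_of_injective _ (FaithfulSMul.algebraMap_injective _ _)]
    exact bot_le)
  exact ⟨Q, hQ, hQP⟩

theorem ne_bot_of_under_ne_bot {Q : Ideal (𝓞 L)} (h : Q.under (𝓞 K) ≠ ⊥) : Q ≠ ⊥ := by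
  rintro rfl
  exact h (Ideal.comap_bot_of_injective _ (FaithfulSMul.algebraMap_injective _ _))

theorem exists_mul_conj_eq_map_of_prime (hσ : σ ≠ 1) {P : Ideal (𝓞 K)} (hP : P.IsPrime) (hP0 : P ≠ ⊥)
    (h2 : 2 ∉ P) {u : (𝓞 K)ˣ} (hu : IsSquare (Ideal.Quotient.mk P (u : 𝓞 K))) {y : 𝓞 L}
    (hy : y ^ 2 = algebraMap (𝓞 K) (𝓞 L) u) (hσy : conj σ y = -y) :
    ∃ Q : Ideal (𝓞 L), Q * Q.map (conj σ) = P.map (algebraMap (𝓞 K) (𝓞 L)) := by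
  obtain ⟨Q, hQ, rfl⟩ := exists_prime_under_eq (L := L) hP
  have hQ0 := ne_bot_of_under_ne_bot hP0
  by_cases hc : Q.map (conj σ) = Q
  · rcases inert_or_ramified hσ hQ0 hc with h | h
    · exfalso
      obtain ⟨x, hx⟩ := hu
      obtain ⟨x, rfl⟩ := Ideal.Quotient.mk_surjective x
      rw [← map_mul, Ideal.Quotient.mk_eq_mk_iff_sub_mem, Ideal.mem_comap, map_sub, map_mul, ← hy,
        show y ^ 2 - algebraMap (𝓞 K) (𝓞 L) x * algebraMap (𝓞 K) (𝓞 L) x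
          = (y - algebraMap (𝓞 K) (𝓞 L) x) * (y + algebraMap (𝓞 K) (𝓞 L) x) by ring] at hx
      have key : 2 * y ∈ Q := by
        rcases hQ.mem_or_mem hx with hx | hx
        · have hx' := hx
          rw [← hc, mem_map_conj hσ, map_sub, hσy, AlgEquiv.commutes] at hx'
          convert sub_mem hx hx' using 1
          ring
        · have hx' := hx
          rw [← hc, mem_map_conj hσ, map_add, hσy, AlgEquiv.commutes] at hx'
          convert sub_mem hx hx' using 1
          ring
      have hyu : IsUnit y := by
        rw [← isUnit_pow_iff two_ne_zero, hy]
        exact u.isUnit.map _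
      rw [Ideal.mul_unit_mem_iff_mem _ hyu] at key
      exact h2 (by rwa [Ideal.mem_comap, map_ofNat])
    · exact ⟨Q, by rw [hc, ← h, pow_two]⟩
  · exact ⟨Q, mul_map_conj_of_ne hQ0 hc⟩

theorem exists_mul_conj_eq_map {I : Ideal (𝓞 K)} (hI : I ≠ ⊥)
    (h : ∀ P : Ideal (𝓞 K), P.IsPrime → P ≠ ⊥ → I ≤ P →
      ∃ Q : Ideal (𝓞 L), Q * Q.map (conj σ) = P.map (algebraMap (𝓞 K) (𝓞 L))) :
    ∃ A : Ideal (𝓞 L), A * A.map (conj σ) = I.map (algebraMap (𝓞 K) (𝓞 L)) := by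
  induction I using UniqueFactorizationMonoid.induction_on_prime with
  | h₁ => exact absurd rfl hI
  | h₂ x hx => exact ⟨⊤, by simp [Ideal.isUnit_iff.1 hx, Ideal.map_top]⟩
  | h₃ a p ha hp ih =>
    obtain ⟨A, hA⟩ := ih ha fun P hP hP0 hle => h P hP hP0 (Ideal.mul_le_right.trans hle)
    obtain ⟨Q, hQ⟩ := h p (Ideal.isPrime_of_prime hp) hp.ne_zero Ideal.mul_le_left
    refine ⟨Q * A, ?_⟩
    rw [Ideal.map_mul, Ideal.map_mul, ← hA, ← hQ, mul_mul_mul_comm]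

theorem exists_aut_mul_eq (hσ : σ ≠ 1) (hL : Odd (Nat.card (ClassGroup (𝓞 L))))
    (hN : normUnits σ = ⊤) {d : 𝓞 K} (hd : d ≠ 0) {A : Ideal (𝓞 L)}
    (hA : A * A.map (conj σ) = (Ideal.span {d}).map (algebraMap (𝓞 K) (𝓞 L))) :
    ∃ z : L, z * σ z = algebraMap K L d := by
  have hd' : algebraMap (𝓞 K) (𝓞 L) d ≠ 0 :=
    (map_ne_zero_iff _ (FaithfulSMul.algebraMap_injective _ _)).2 hd
  rw [Ideal.map_span, Set.image_singleton] at hA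
  have hA0 : A ≠ ⊥ := by
    rintro rfl
    rw [Ideal.bot_mul, eq_comm, Ideal.span_singleton_eq_bot] at hA
    exact hd' hA
  obtain ⟨k, hk⟩ := hL
  have hp : (A ^ (2 * k + 1)).IsPrincipal := by
    have h1 : ClassGroup.mk0 (⟨A, mem_nonZeroDivisors_of_ne_zero hA0⟩ ^ (2 * k + 1) : (Ideal (𝓞 L))⁰) = 1 := by
      rw [map_pow, ← hk, pow_card_eq_one']
    exact (ClassGroup.mk0_eq_one_iff _).1 h1
  obtain ⟨α, hα⟩ := hp
  rw [Ideal.submodule_span_eq] at hα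
  have h1 := congrArg (· ^ (2 * k + 1)) hA
  simp only [mul_pow, ← Ideal.map_pow, hα, Ideal.map_span, Set.image_singleton,
    Ideal.span_singleton_mul_span_singleton, Ideal.span_singleton_pow] at h1
  obtain ⟨ε, hε⟩ := Ideal.span_singleton_eq_span_singleton.1 h1.symm
  have hσε : conj σ (ε : 𝓞 L) = ε := by
    refine mul_left_cancel₀ (pow_ne_zero (2 * k + 1) hd') ?_
    rw [hε]
    conv_lhs => rw [← AlgEquiv.commutes (conj σ) d, ← map_pow, ← map_mul, hε, map_mul, conj_conj hσ, mul_comm]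
  have hmem : unitHom L ε ∈ (toPrincipalIdeal (𝓞 L) L).ker ⊓ fix (unitsConj σ) :=
    ⟨ker_toPrincipalIdeal.ge ⟨ε, rfl⟩, Units.ext (congrArg (algebraMap (𝓞 L) L) hσε)⟩
  rw [ker_inf_fix hσ] at hmem
  obtain ⟨e, he⟩ := hmem
  have he' : algebraMap K L (e : 𝓞 K) = ((ε : 𝓞 L) : L) := congrArg Units.val he
  obtain ⟨y, hy⟩ := mem_normUnits.1 (hN.ge (Subgroup.mem_top e))
  have hy0 : y * σ y ≠ 0 := by
    rw [hy, he']
    exact (unitHom L ε).ne_zero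
  have hdL : algebraMap K L d ≠ 0 := by simpa using hd
  have hε' : (algebraMap K L d) ^ (2 * k + 1) * (y * σ y) = (α : L) * σ α := by
    rw [hy, he']
    exact congrArg (algebraMap (𝓞 L) L) hε
  refine ⟨α / y / algebraMap K L d ^ k, ?_⟩
  rw [map_div₀, map_div₀, map_pow, σ.commutes, div_mul_div_comm, div_mul_div_comm, ← hε',
    mul_div_cancel_right₀ _ hy0]
  field_simp
  ring

/-- The prime ideals containing the integer `d`. -/
def primesAt (K : Type*) [Field K] (d : ℤ) : Set (Ideal (𝓞 K)) :=
  {P | P.IsPrime ∧ (d : 𝓞 K) ∈ P}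

/-- The units that are squares modulo all prime ideals containing `d`. -/
def squareUnits (K : Type*) [Field K] (d : ℤ) : Subgroup (𝓞 K)ˣ where
  carrier := {u | ∀ P ∈ primesAt K d, IsSquare (Ideal.Quotient.mk P (u : 𝓞 K))}
  one_mem' P _ := by rw [Units.val_one, map_one]; exact IsSquare.one
  mul_mem' hu hv P hP := by rw [Units.val_mul, map_mul]; exact (hu P hP).mul (hv P hP)
  inv_mem' {u} hu P hP := by
    have h : ((u⁻¹ : (𝓞 K)ˣ) : 𝓞 K) = (u⁻¹ : (𝓞 K)ˣ) * (u⁻¹ : (𝓞 K)ˣ) * (u : 𝓞 K) := by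
      rw [mul_assoc, Units.inv_mul, mul_one]
    rw [h, map_mul, map_mul]
    exact (IsSquare.mul_self _).mul (hu P hP)

/-- Number fields containing a square root of `-1`, with odd class number and at most one prime
ideal above `2`. -/
structure IsTwoRegular (K : Type*) [Field K] [NumberField K] : Prop where
  exists_sq_eq_neg_one : ∃ i : K, i ^ 2 = -1
  odd_card : Odd (Nat.card (ClassGroup (𝓞 K)))
  eq_of_two_mem : ∀ P Q : Ideal (𝓞 K), P.IsPrime → Q.IsPrime → 2 ∈ P → 2 ∈ Q → P = Q

/-- The integer `d` is odd and not divisible by the square of a prime ideal of `K`. -/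
structure IsOddUnramified (K : Type*) [Field K] (d : ℤ) : Prop where
  odd : Odd d
  notMem_sq : ∀ P ∈ primesAt K d, (d : 𝓞 K) ∉ P ^ 2

theorem IsOddUnramified.two_notMem {d : ℤ} (hd : IsOddUnramified K d) {P : Ideal (𝓞 K)}
    (hP : P ∈ primesAt K d) : 2 ∉ P := by
  intro h2
  obtain ⟨k, rfl⟩ := hd.odd
  refine hP.1.ne_top (P.eq_top_iff_one.2 ?_)
  have := sub_mem hP.2 (P.mul_mem_right (k : 𝓞 K) h2)
  push_cast at this
  convert this using 1
  ring

theorem intCast_ne_zero_of_odd {d : ℤ} (hd : Odd d) : (d : 𝓞 K) ≠ 0 := by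
  rw [Int.cast_ne_zero]
  rintro rfl
  simp at hd

theorem isSquare_mk_of_sub_eq {d : ℤ} (hd : IsOddUnramified K d) {P : Ideal (𝓞 K)}
    (hP : P ∈ primesAt K d) {u : (𝓞 K)ˣ} {b c : K} (h : b ^ 2 - d * c ^ 2 = (u : 𝓞 K)) :
    IsSquare (Ideal.Quotient.mk P (u : 𝓞 K)) := by
  have hd0 := intCast_ne_zero_of_odd (K := K) hd.odd
  have hP0 : P ≠ ⊥ := by
    rintro rfl
    exact hd0 hP.2
  let v : HeightOneSpectrum (𝓞 K) := ⟨P, hP.1, hP0⟩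
  have hvd : v.valuation K (d : K) = WithZero.exp (-1 : ℤ) := by
    have h1 := (v.intValuation_le_pow_iff_mem (d : 𝓞 K) 1).2 (by simpa using hP.2)
    have h2 := mt (v.intValuation_le_pow_iff_mem (d : 𝓞 K) 2).1 (hd.notMem_sq P hP)
    have h3 : v.valuation K ((d : 𝓞 K) : K) = v.intValuation (d : 𝓞 K) := v.valuation_of_algebraMap _
    rw [v.intValuation_eq_exp_neg_multiplicity hd0] at h1 h2 h3
    rw [WithZero.exp_le_exp] at h1 h2
    rw [show ((d : 𝓞 K) : K) = d from map_intCast (algebraMap (𝓞 K) K) d] at h3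
    rw [h3, WithZero.exp_inj]
    push_cast at h1 h2
    omega
  have hu : v.valuation K ((u : 𝓞 K) : K) = 1 := by
    rw [v.valuation_eq_one_iff_notMem]
    exact fun hm => hP.1.ne_top (P.eq_top_of_isUnit_mem hm u.isUnit)
  have hlt : v.valuation K (d * c ^ 2) < 1 ∧ v.valuation K b ≤ 1 := by
    rw [← h] at hu
    by_cases hb : b = 0
    · exfalso
      have hc : v.valuation K c ≠ 0 := by
        intro hc
        simp [hb, hc] at hu
      rw [hb, zero_pow two_ne_zero, zero_sub, Valuation.map_neg, map_mul, map_pow, hvd,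
        ← WithZero.exp_log hc, ← WithZero.exp_nsmul, ← WithZero.exp_add, WithZero.exp_eq_one] at hu
      simp only [nsmul_eq_mul] at hu
      omega
    by_cases hc : c = 0
    · rw [hc, zero_pow two_ne_zero, mul_zero, sub_zero, map_pow] at hu
      exact ⟨by simp [hc], ((pow_eq_one_iff_of_nonneg _root_.zero_le two_ne_zero).1 hu).le⟩
    have hb' : v.valuation K b ≠ 0 := by simpa using hb
    have hc' : v.valuation K c ≠ 0 := by simpa using hc
    have e1 : v.valuation K (b ^ 2) = WithZero.exp (2 * WithZero.log (v.valuation K b)) := by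
      rw [map_pow, two_mul, WithZero.exp_add, WithZero.exp_log hb', pow_two]
    have e2 : v.valuation K (d * c ^ 2) = WithZero.exp (-1 + 2 * WithZero.log (v.valuation K c)) := by
      rw [map_mul, map_pow, hvd, two_mul, WithZero.exp_add, WithZero.exp_add, WithZero.exp_log hc', pow_two]
    have hne : v.valuation K (b ^ 2) ≠ v.valuation K (d * c ^ 2) := by
      rw [e1, e2, Ne, WithZero.exp_inj]
      omega
    rw [← (v.valuation K).map_neg (d * c ^ 2)] at hne
    rw [sub_eq_add_neg, (v.valuation K).map_add_of_distinct_val hne, Valuation.map_neg] at hu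
    have h1 := (le_max_left _ _).trans hu.le
    have h2 := (le_max_right _ _).trans hu.le
    rw [e1, ← WithZero.exp_zero, WithZero.exp_le_exp] at h1
    rw [e2, ← WithZero.exp_zero, WithZero.exp_le_exp] at h2
    rw [e2, ← WithZero.exp_log hb', ← WithZero.exp_zero, WithZero.exp_le_exp, WithZero.exp_lt_exp]
    omega
  obtain ⟨a, ha⟩ := v.exists_valuation_sub_lt_of_integer hlt.2 1
  refine ⟨Ideal.Quotient.mk P a, ?_⟩
  rw [← map_mul, Ideal.Quotient.mk_eq_mk_iff_sub_mem]
  change _ ∈ v.asIdeal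
  rw [← v.valuation_lt_one_iff_mem (K := K)]
  change v.valuation K (((u : 𝓞 K) : K) - (a : K) * a) < 1
  rw [← Valuation.map_neg, ← h, show -(b ^ 2 - d * c ^ 2 - (a : K) * a)
    = ((a : K) - b) * ((a : K) + b) + d * c ^ 2 by ring]
  refine (v.valuation K).map_add_lt ?_ hlt.1
  rw [map_mul]
  refine mul_lt_one_of_lt_of_le ha ?_
  exact ((v.valuation K).map_add_le (v.valuation_le_one a) hlt.2)

end NormResidue

section IndexFormula

variable {K L : Type*} [Field K] [NumberField K] [Field L] [NumberField L] [Algebra K L]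
  [Algebra.IsQuadraticExtension K L] {σ : L ≃ₐ[K] L} {d : ℤ}

theorem squareUnits_le_normUnits (hσ : σ ≠ 1) (hK : IsTwoRegular K) (hd : IsOddUnramified K d)
    (hdK : ¬ IsSquare (d : K)) {x : L} (hx : x ^ 2 = algebraMap K L d) :
    squareUnits K d ≤ normUnits σ := by
  intro u hu
  rw [mem_normUnits]
  by_cases hsq : IsSquare ((u : 𝓞 K) : K)
  · obtain ⟨b, hb⟩ := hsq
    exact ⟨algebraMap K L b, by rw [σ.commutes, ← map_mul, hb]⟩
  obtain ⟨M, _, _, _, _, w, hw⟩ := exists_isQuadraticExtension hsq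
  obtain ⟨τ, hτ⟩ := exists_aut_ne_one K M
  obtain ⟨i, hi⟩ := hK.exists_sq_eq_neg_one
  obtain ⟨hM, hN⟩ := odd_card_and_normUnits_eq_top hτ hi hK.odd_card hK.eq_of_two_mem hsq hw
  have hτw := aut_eq_neg hτ hsq hw
  obtain ⟨y, rfl⟩ := exists_int_of_sq hw
  have hd0 := intCast_ne_zero_of_odd (K := K) hd.odd
  obtain ⟨A, hA⟩ := exists_mul_conj_eq_map (σ := τ) (I := Ideal.span {(d : 𝓞 K)})
    (by rwa [Ne, Ideal.span_singleton_eq_bot]) fun P hP hP0 hle => by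
      have hPd : P ∈ primesAt K d := ⟨hP, (Ideal.span_singleton_le_iff_mem _).1 hle⟩
      exact exists_mul_conj_eq_map_of_prime hτ hP hP0 (hd.two_notMem hPd) (hu P hPd)
        (RingOfIntegers.ext hw) (RingOfIntegers.ext hτw)
  obtain ⟨b, c, hbc⟩ := (exists_mul_conj_eq_iff hτ hsq hw _).1 (exists_aut_mul_eq hτ hM hN hd0 hA)
  rw [show ((d : 𝓞 K) : K) = d from map_intCast (algebraMap (𝓞 K) K) d] at hbc
  have hc : c ≠ 0 := by
    rintro rfl
    exact hdK ⟨b, by rw [← hbc]; ring⟩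
  refine (exists_mul_conj_eq_iff hσ hdK hx _).2 ⟨b / c, 1 / c, ?_⟩
  rw [← hbc]
  field_simp
  ring

theorem normUnits_eq_squareUnits (hσ : σ ≠ 1) (hK : IsTwoRegular K) (hd : IsOddUnramified K d)
    (hdK : ¬ IsSquare (d : K)) {x : L} (hx : x ^ 2 = algebraMap K L d) :
    normUnits σ = squareUnits K d := by
  refine le_antisymm (fun u hu P hP => ?_) (squareUnits_le_normUnits hσ hK hd hdK hx)
  obtain ⟨b, c, hbc⟩ := (exists_mul_conj_eq_iff hσ hdK hx _).1 (mem_normUnits.1 hu)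
  exact isSquare_mk_of_sub_eq hd hP hbc

theorem exists_half_integer (hK : IsTwoRegular K) (hd : Odd d) {y : 𝓞 L}
    (hy : y ^ 2 = d) : ∃ (e : (𝓞 K)ˣ) (z : 𝓞 L), 2 * z = 1 + algebraMap (𝓞 K) (𝓞 L) e * y := by
  obtain ⟨e, m, he⟩ : ∃ (e : (𝓞 K)ˣ) (m : ℤ), (e : 𝓞 K) ^ 2 * d = 1 + 4 * m := by
    obtain h | h : d % 4 = 1 ∨ d % 4 = 3 := by
      have := Int.odd_iff.1 hd
      omega
    · refine ⟨1, d / 4, ?_⟩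
      rw [Units.val_one, one_pow, one_mul]
      exact_mod_cast (by omega : d = 1 + 4 * (d / 4))
    · obtain ⟨i, hi⟩ := hK.exists_sq_eq_neg_one
      obtain ⟨e, he⟩ := exists_unit_eq hi
      refine ⟨e, -d / 4, ?_⟩
      rw [show (e : 𝓞 K) ^ 2 = -1 from RingOfIntegers.ext (by
        change ((e : 𝓞 K) : K) ^ 2 = -1
        rw [he, hi]), neg_one_mul]
      exact_mod_cast (by omega : -d = 1 + 4 * (-d / 4))
  have ht : (algebraMap (𝓞 K) (𝓞 L) e * y) ^ 2 = 1 + 4 * m := by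
    have h := congrArg (algebraMap (𝓞 K) (𝓞 L)) he
    rwa [map_mul, map_pow, map_intCast, ← hy, ← mul_pow, map_add, map_mul, map_one, map_ofNat,
      map_intCast] at h
  refine ⟨e, ?_⟩
  generalize algebraMap (𝓞 K) (𝓞 L) e * y = t at ht ⊢
  have ht : (t : L) ^ 2 = 1 + 4 * m := by
    have h := congrArg (algebraMap (𝓞 L) L) ht
    rwa [map_pow, map_add, map_mul, map_one, map_intCast, map_ofNat] at h
  refine ⟨⟨(1 + t) / 2, ?_⟩, RingOfIntegers.ext ?_⟩
  · refine ⟨Polynomial.X ^ 2 - Polynomial.X - Polynomial.C m, by monicity!, ?_⟩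
    simp only [Polynomial.eval₂_sub, Polynomial.eval₂_pow, Polynomial.eval₂_X, Polynomial.eval₂_C]
    rw [eq_intCast]
    linear_combination ht / 4
  · exact mul_div_cancel₀ (1 + (t : L)) two_ne_zero

theorem mem_under_of_ramified (hσ : σ ≠ 1) (hK : IsTwoRegular K) (hd : Odd d) {y : 𝓞 L}
    (hy : y ^ 2 = d) (hσy : conj σ y = -y)
    {v : HeightOneSpectrum (𝓞 L)} (hv : v ∈ ramified K L) : (d : 𝓞 K) ∈ v.asIdeal.under (𝓞 K) := by
  obtain ⟨e, z, hz⟩ := exists_half_integer hK hd hy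
  have h1 := congrArg (conj σ) hz
  rw [map_mul, map_add, map_mul, AlgEquiv.commutes, hσy, map_one, map_ofNat] at h1
  have h2 : conj σ z - z = -(algebraMap (𝓞 K) (𝓞 L) e * y) :=
    mul_left_cancel₀ (two_ne_zero) (by linear_combination h1 - hz)
  have h3 := conj_sub_mem_of_ramified hσ hv z
  rw [h2, neg_mem_iff, Ideal.unit_mul_mem_iff_mem _ (e.isUnit.map _)] at h3
  rw [Ideal.mem_comap, map_intCast, ← hy]
  exact Ideal.pow_mem_of_mem _ h3 2 two_pos

theorem exists_ramified_of_mem (hσ : σ ≠ 1) (hd : IsOddUnramified K d) {y : 𝓞 L}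
    (hy : y ^ 2 = d) (hσy : conj σ y = -y) {P : Ideal (𝓞 K)} (hP : P ∈ primesAt K d) :
    ∃ v ∈ ramified K L, v.asIdeal.under (𝓞 K) = P := by
  have hP0 : P ≠ ⊥ := by
    rintro rfl
    exact intCast_ne_zero_of_odd (K := K) hd.odd hP.2
  obtain ⟨Q, hQ, rfl⟩ := exists_prime_under_eq (L := L) hP.1
  have hQ0 := ne_bot_of_under_ne_bot hP0
  have hyQ : y ∈ Q := hQ.mem_of_pow_mem 2 (by
    have := hP.2
    rwa [Ideal.mem_comap, map_intCast, ← hy] at this)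
  have hnot : y ∉ (Q.under (𝓞 K)).map (algebraMap (𝓞 K) (𝓞 L)) := by
    intro h
    refine hd.notMem_sq _ hP ?_
    have h2 := Ideal.mul_mem_mul h h
    rw [← Ideal.map_mul, ← pow_two, ← pow_two, hy, ← map_intCast (algebraMap (𝓞 K) (𝓞 L)),
      ← Ideal.mem_comap, Ideal.comap_map_eq_self_of_faithfullyFlat] at h2
    exact h2
  have hc : Q.map (conj σ) = Q := by
    by_contra hc
    refine hnot ?_
    have hQm := hQ.isMaximal hQ0
    have hyQ' : y ∈ Q.map (conj σ) := by rwa [mem_map_conj hσ, hσy, neg_mem_iff]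
    have : (Q.map (conj σ)).IsPrime := Ideal.map_isPrime_of_equiv _
    rw [← mul_map_conj_of_ne hQ0 hc, Ideal.mul_eq_inf_of_coprime]
    · exact ⟨hyQ, hyQ'⟩
    · refine hQm.coprime_of_ne (this.isMaximal ?_) (Ne.symm hc)
      rwa [Ne, Ideal.map_eq_bot_iff_of_injective (conj σ).injective]
  refine ⟨⟨Q, hQ, hQ0⟩, (inert_or_ramified hσ hQ0 hc).resolve_left fun h => hnot (h ▸ hyQ), rfl⟩

theorem ncard_ramified (hσ : σ ≠ 1) (hK : IsTwoRegular K) (hd : IsOddUnramified K d)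
    {y : 𝓞 L} (hy : y ^ 2 = d) (hσy : conj σ y = -y) :
    (ramified K L).ncard = (primesAt K d).ncard := by
  refine Set.ncard_congr (fun v _ => v.asIdeal.under (𝓞 K)) ?_ ?_ ?_
  · exact fun v hv => ⟨inferInstance, mem_under_of_ramified hσ hK hd.odd hy hσy hv⟩
  · exact fun v w hv hw h => eq_of_mem_ramified hv hw h
  · intro P hP
    obtain ⟨v, hv, h⟩ := exists_ramified_of_mem hσ hd hy hσy hP
    exact ⟨v, hv, h⟩

variable (L) in
theorem two_mul_sqIndex_mul_index (hK : IsTwoRegular K) (hd : IsOddUnramified K d)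
    (hdK : ¬ IsSquare (d : K)) {x : L} (hx : x ^ 2 = d) :
    2 * sqIndex L * (squareUnits K d).index = 2 ^ (primesAt K d).ncard := by
  obtain ⟨σ, hσ⟩ := exists_aut_ne_one K L
  obtain ⟨i, hi⟩ := hK.exists_sq_eq_neg_one
  have hx' : x ^ 2 = algebraMap K L (d : K) := by rw [hx, map_intCast]
  obtain ⟨y, rfl⟩ := exists_int_of_sq (K := K) (a := d) (x := x) (by
    rw [hx, show ((d : 𝓞 K) : K) = d from map_intCast (algebraMap (𝓞 K) K) d, map_intCast])
  have hy : y ^ 2 = d := RingOfIntegers.ext (by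
    rw [show ((d : 𝓞 L) : L) = d from map_intCast (algebraMap (𝓞 L) L) d]
    exact hx)
  rw [← normUnits_eq_squareUnits hσ hK hd hdK hx', genus_formula hσ hi hK.odd_card,
    ncard_ramified hσ hK hd hy (RingOfIntegers.ext (aut_eq_neg hσ hdK hx'))]

end IndexFormula

section Cyclotomic

theorem isPrincipalIdealRing_of_four (K : Type*) [Field K] [NumberField K]
    [IsCyclotomicExtension {2 ^ 2} ℚ K] : IsPrincipalIdealRing (𝓞 K) := by
  apply RingOfIntegers.isPrincipalIdealRing_of_abs_discr_lt
  have ht : Nat.totient (2 ^ 2) = 2 := by decide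
  rw [IsCyclotomicExtension.Rat.discr_prime_pow 2 2 K, IsCyclotomicExtension.Rat.finrank (2 ^ 2) K,
    IsCyclotomicExtension.Rat.nrComplexPlaces_eq_totient_div_two (2 ^ 2) K, ht]
  norm_num
  have := Real.pi_gt_three
  nlinarith

section Subfield

variable {L : Type*} [Field L] [NumberField L] {n : ℕ} {η : L}

theorem isCyclotomicExtension_adjoin_sq (hη : IsPrimitiveRoot η (2 ^ (n + 1))) :
    IsCyclotomicExtension {2 ^ n} ℚ (IntermediateField.adjoin ℚ {η ^ 2}) :=
  (hη.pow (by positivity) (pow_succ' 2 n)).intermediateField_adjoin_isCyclotomicExtension ℚ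

theorem isQuadraticExtension_of_isCyclotomicExtension {K : Type*} [Field K] [NumberField K] [Algebra K L]
    (hn : 1 ≤ n) [IsCyclotomicExtension {2 ^ (n + 1)} ℚ L] [IsCyclotomicExtension {2 ^ n} ℚ K] :
    Algebra.IsQuadraticExtension K L where
  finrank_eq_two' := by
    have h := Module.finrank_mul_finrank ℚ K L
    obtain ⟨n, rfl⟩ := Nat.exists_eq_add_of_le' hn
    rw [IsCyclotomicExtension.Rat.finrank (2 ^ (n + 1)) K,
      IsCyclotomicExtension.Rat.finrank (2 ^ (n + 1 + 1)) L,
      Nat.totient_prime_pow_succ Nat.prime_two, Nat.totient_prime_pow_succ Nat.prime_two,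
      pow_succ, Nat.add_one_sub_one, mul_one, mul_one] at h
    exact Nat.eq_of_mul_eq_mul_left (by positivity) h

theorem isPrimitiveRoot_of_sq {K : Type*} [Field K] {x : K} (hn : 1 ≤ n)
    (hx : IsPrimitiveRoot (x ^ 2) (2 ^ n)) : IsPrimitiveRoot x (2 ^ (n + 1)) := by
  rw [IsPrimitiveRoot.iff_orderOf]
  refine orderOf_eq_prime_pow ?_ ?_
  · intro h
    obtain ⟨n, rfl⟩ := Nat.exists_eq_add_of_le' hn
    rw [pow_succ', pow_mul] at h
    refine absurd (Nat.le_of_dvd (by positivity) ((hx.pow_eq_one_iff_dvd _).1 h)) ?_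
    rw [pow_succ]
    have := Nat.pos_of_neZero (2 ^ n)
    omega
  · rw [pow_succ', pow_mul, hx.pow_eq_one]

theorem not_isSquare_of_isPrimitiveRoot {K : Type*} [Field K] [NumberField K] {ζ : K} (hn : 1 ≤ n)
    [IsCyclotomicExtension {2 ^ n} ℚ K] (hζ : IsPrimitiveRoot ζ (2 ^ n)) : ¬ IsSquare ζ := by
  rintro ⟨x, hx⟩
  rw [← pow_two] at hx
  have hx' := isPrimitiveRoot_of_sq hn (hx ▸ hζ)
  have h := (IntermediateField.adjoin ℚ {x}).val.toLinearMap.finrank_le_finrank_of_injective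
    (IntermediateField.adjoin ℚ {x}).val.injective
  have : IsCyclotomicExtension {2 ^ (n + 1)} ℚ (IntermediateField.adjoin ℚ {x}) := hx'.intermediateField_adjoin_isCyclotomicExtension ℚ
  obtain ⟨n, rfl⟩ := Nat.exists_eq_add_of_le' hn
  rw [IsCyclotomicExtension.Rat.finrank (2 ^ (n + 1)) K,
    IsCyclotomicExtension.Rat.finrank (2 ^ (n + 1 + 1)) (IntermediateField.adjoin ℚ {x}),
    Nat.totient_prime_pow_succ Nat.prime_two, Nat.totient_prime_pow_succ Nat.prime_two,
    pow_succ, Nat.add_one_sub_one, mul_one, mul_one] at h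
  have := Nat.pos_of_neZero (2 ^ n)
  omega

end Subfield

theorem eq_of_two_mem_of_isCyclotomicExtension (K : Type*) [Field K] [NumberField K] {n : ℕ}
    (hn : 1 ≤ n) [h : IsCyclotomicExtension {2 ^ n} ℚ K] {P Q : Ideal (𝓞 K)} (hP : P.IsPrime)
    (hQ : Q.IsPrime) (h2P : 2 ∈ P) (h2Q : 2 ∈ Q) : P = Q := by
  obtain ⟨n, rfl⟩ := Nat.exists_eq_add_of_le' hn
  have key : ∀ P : Ideal (𝓞 K), P.IsPrime → 2 ∈ P →
      P = Ideal.span {(IsCyclotomicExtension.zeta_spec (2 ^ (n + 1)) ℚ K).toInteger - 1} := by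
    intro P hP h2
    have hlo : P.LiesOver (Ideal.span {((2 : ℕ) : ℤ)}) := ⟨by
      have : (Ideal.span {((2 : ℕ) : ℤ)}).IsMaximal := Int.ideal_span_isMaximal_of_prime 2
      refine this.eq_of_le (Ideal.IsPrime.under ℤ P).ne_top ?_
      rw [Ideal.span_singleton_le_iff_mem, Ideal.mem_comap]
      simpa using h2⟩
    exact IsCyclotomicExtension.Rat.eq_span_zeta_sub_one_of_liesOver 2 n K (IsCyclotomicExtension.zeta_spec (2 ^ (n + 1)) ℚ K) P
  rw [key P hP h2P, key Q hQ h2Q]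

theorem exists_sq_eq_neg_one_of_isPrimitiveRoot {K : Type*} [Field K] {n : ℕ} (hn : 2 ≤ n) {ζ : K}
    (hζ : IsPrimitiveRoot ζ (2 ^ n)) : ∃ i : K, i ^ 2 = -1 := by
  obtain ⟨n, rfl⟩ := Nat.exists_eq_add_of_le' hn
  refine ⟨ζ ^ 2 ^ n, ?_⟩
  rw [← pow_mul, ← pow_succ]
  exact (hζ.pow (by positivity) (pow_succ 2 (n + 1))).eq_neg_one_of_two_right

section Step

variable {K L : Type*} [Field K] [NumberField K] [Field L] [NumberField L] [Algebra K L] {n : ℕ}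

theorem exists_sq_eq_algebraMap [IsCyclotomicExtension {2 ^ (n + 1)} ℚ L] {ζ : K}
    (hζ : IsPrimitiveRoot ζ (2 ^ n)) : ∃ x : L, x ^ 2 = algebraMap K L ζ := by
  have hη := IsCyclotomicExtension.zeta_spec (2 ^ (n + 1)) ℚ L
  obtain ⟨k, -, hk⟩ := (hη.pow (by positivity) (pow_succ' 2 n)).eq_pow_of_pow_eq_one
    (hζ.map_of_injective (algebraMap K L).injective).pow_eq_one
  exact ⟨_, by rw [← hk, ← pow_mul, mul_comm, pow_mul]⟩

/-- A primitive root of unity as a unit of the ring of integers. -/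
noncomputable def rootUnit {ζ : K} (hζ : IsPrimitiveRoot ζ (2 ^ n)) : (𝓞 K)ˣ :=
  (hζ.toInteger_isPrimitiveRoot.isUnit (by positivity)).unit

theorem odd_card_and_normUnits_of_isCyclotomicExtension (hn : 2 ≤ n)
    [IsCyclotomicExtension {2 ^ n} ℚ K] [IsCyclotomicExtension {2 ^ (n + 1)} ℚ L]
    [Algebra.IsQuadraticExtension K L] {σ : L ≃ₐ[K] L} (hσ : σ ≠ 1)
    (hK : Odd (Nat.card (ClassGroup (𝓞 K)))) :
    Odd (Nat.card (ClassGroup (𝓞 L))) ∧ normUnits σ = ⊤ := by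
  have hζ := IsCyclotomicExtension.zeta_spec (2 ^ n) ℚ K
  obtain ⟨x, hx⟩ := exists_sq_eq_algebraMap (L := L) hζ
  obtain ⟨i, hi⟩ := exists_sq_eq_neg_one_of_isPrimitiveRoot hn hζ
  exact odd_card_and_normUnits_eq_top hσ hi hK
    (fun P Q hP hQ h h' => eq_of_two_mem_of_isCyclotomicExtension K (one_le_two.trans hn) hP hQ h h')
    (u := rootUnit hζ) (not_isSquare_of_isPrimitiveRoot (one_le_two.trans hn) hζ) hx

end Step

theorem odd_card_of_isCyclotomicExtension {n : ℕ} (hn : 2 ≤ n) (K : Type*) [Field K] [NumberField K]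
    [IsCyclotomicExtension {2 ^ n} ℚ K] : Odd (Nat.card (ClassGroup (𝓞 K))) := by
  induction n, hn using Nat.le_induction generalizing K with
  | base =>
    have := isPrincipalIdealRing_of_four K
    rw [Nat.card_eq_fintype_card, card_classGroup_eq_one_iff.2 this]
    exact odd_one
  | succ n hn ih =>
    have hη := IsCyclotomicExtension.zeta_spec (2 ^ (n + 1)) ℚ K
    let F := IntermediateField.adjoin ℚ {IsCyclotomicExtension.zeta (2 ^ (n + 1)) ℚ K ^ 2}
    have : IsCyclotomicExtension {2 ^ n} ℚ F := isCyclotomicExtension_adjoin_sq hη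
    have := isQuadraticExtension_of_isCyclotomicExtension (L := K) (K := F) (one_le_two.trans hn)
    obtain ⟨σ, hσ⟩ := exists_aut_ne_one F K
    exact (odd_card_and_normUnits_of_isCyclotomicExtension hn hσ (ih F)).1

theorem isTwoRegular_of_isCyclotomicExtension {n : ℕ} (hn : 2 ≤ n) (K : Type*) [Field K]
    [NumberField K] [IsCyclotomicExtension {2 ^ n} ℚ K] : IsTwoRegular K where
  exists_sq_eq_neg_one :=
    exists_sq_eq_neg_one_of_isPrimitiveRoot hn (IsCyclotomicExtension.zeta_spec (2 ^ n) ℚ K)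
  odd_card := odd_card_of_isCyclotomicExtension hn K
  eq_of_two_mem _ _ hP hQ h h' :=
    eq_of_two_mem_of_isCyclotomicExtension K (one_le_two.trans hn) hP hQ h h'

end Cyclotomic

section Unramified

variable {K : Type*} [Field K] [NumberField K] {d : ℤ}

theorem ne_bot_of_mem_primesAt (hd : d ≠ 0) {P : Ideal (𝓞 K)} (hP : P ∈ primesAt K d) : P ≠ ⊥ := by
  rintro rfl
  exact hd (Int.cast_eq_zero.1 hP.2)

theorem exists_prime_of_mem_primesAt (hd : d ≠ 0) {P : Ideal (𝓞 K)} (hP : P ∈ primesAt K d) :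
    ∃ p : ℕ, p.Prime ∧ (p : ℤ) ∣ d ∧ ∀ m : ℤ, (m : 𝓞 K) ∈ P ↔ (p : ℤ) ∣ m := by
  have := hP.1
  have : NeZero P := ⟨ne_bot_of_mem_primesAt hd hP⟩
  exact ⟨_, Nat.absNorm_under_prime P, Int.cast_mem_ideal_iff.1 hP.2, fun m => Int.cast_mem_ideal_iff⟩

theorem nonempty_primesAt {p : ℕ} (hp : p.Prime) (h : (p : ℤ) ∣ d) : (primesAt K d).Nonempty := by
  have : Fact p.Prime := ⟨hp⟩
  have hm : (Ideal.span {(p : ℤ)}).IsMaximal := Int.ideal_span_isMaximal_of_prime p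
  obtain ⟨Q, -, hQ, hQP⟩ := Ideal.exists_ideal_over_prime_of_isIntegral (Ideal.span {(p : ℤ)})
    (⊥ : Ideal (𝓞 K)) (by
      rw [Ideal.comap_bot_of_injective _ (FaithfulSMul.algebraMap_injective _ _)]
      exact bot_le)
  have hdQ := (Ideal.mem_span_singleton.2 h)
  rw [← hQP, Ideal.mem_comap] at hdQ
  exact ⟨Q, hQ, by simpa using hdQ⟩

theorem isOddUnramified_of_isCyclotomicExtension {n : ℕ} [IsCyclotomicExtension {2 ^ n} ℚ K]
    (hsf : Squarefree d) (hodd : Odd d) : IsOddUnramified K d where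
  odd := hodd
  notMem_sq P hP h := by
    obtain ⟨p, hp, ⟨m, rfl⟩, hpm⟩ := exists_prime_of_mem_primesAt hsf.ne_zero hP
    have hP0 := ne_bot_of_mem_primesAt hsf.ne_zero hP
    have := hP.1
    have : Fact p.Prime := ⟨hp⟩
    have hm : (Ideal.span {(p : ℤ)}).IsMaximal := Int.ideal_span_isMaximal_of_prime p
    have hlo : P.LiesOver (Ideal.span {(p : ℤ)}) := ⟨by
      ext m
      rw [Ideal.mem_comap, Ideal.mem_span_singleton, ← hpm]
      simp⟩
    have h2 : ¬ p ∣ 2 ^ n := by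
      intro h
      have := (Nat.prime_dvd_prime_iff_eq hp Nat.prime_two).1 (hp.dvd_of_dvd_pow h)
      subst this
      exact absurd hodd (by simp)
    have hr := IsCyclotomicExtension.Rat.ramificationIdx_eq_of_not_dvd (m := 2 ^ n) (p := p) (K := K) (P := P) h2
    have hle : (Ideal.span {(p : ℤ)}).map (algebraMap ℤ (𝓞 K)) ≤ P := Ideal.map_le_of_le_comap hlo.over.le
    rw [← Ideal.ramificationIdx'_eq_ramificationIdx (Ideal.span {(p : ℤ)}) P (by simpa using hp.ne_zero)] at hr
    refine (Ideal.ramificationIdx'_ne_one_iff hle).2 ?_ hr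
    rw [Ideal.map_span, Set.image_singleton, Ideal.span_singleton_le_iff_mem, map_natCast]
    rw [mul_comm] at h
    push_cast at h
    refine ((Ideal.IsPrime.mul_mem_pow P h).resolve_left fun hmP => ?_)
    obtain ⟨k, rfl⟩ := (hpm m).1 hmP
    have := hsf p ⟨k, by ring⟩
    exact (Nat.prime_iff_prime_int.1 hp).not_isUnit this

theorem IsOddUnramified.not_isSquare (hd : IsOddUnramified K d) (h : (primesAt K d).Nonempty) :
    ¬ IsSquare (d : K) := by
  rintro ⟨b, hb⟩
  obtain ⟨P, hP⟩ := h
  have hsint : IsIntegral ℤ b := IsIntegral.of_pow two_pos (by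
    rw [pow_two, ← hb]; exact isIntegral_algebraMap (R := ℤ) (A := K) (x := d))
  obtain ⟨b, rfl⟩ : ∃ y : 𝓞 K, (y : K) = b := ⟨⟨b, hsint⟩, rfl⟩
  have h1 : (d : 𝓞 K) = b ^ 2 := RingOfIntegers.ext (by rw [pow_two]; simpa using hb)
  refine hd.notMem_sq P hP ?_
  have h2 := hP.2
  rw [h1] at h2 ⊢
  exact Ideal.pow_mem_pow (hP.1.mem_of_pow_mem _ h2) 2

end Unramified

theorem exists_pow_eq_one_add {p n : ℕ} (hn : 4 ≤ n)
    (hp : p % 8 = 3 ∨ p % 8 = 5 ∨ p % 16 = 7 ∨ p % 16 = 9) :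
    ∃ j k : ℕ, p ^ j = 1 + 2 ^ n * (2 * k + 1) := by
  induction n, hn using Nat.le_induction with
  | base =>
    have h : p ^ 2 % 32 = 17 ∨ p ^ 4 % 32 = 17 := by
      have h32 : p % 32 < 32 := Nat.mod_lt _ (by norm_num)
      rw [Nat.pow_mod, Nat.pow_mod p 4]
      have h8 : p % 8 = p % 32 % 8 := by omega
      have h16 : p % 16 = p % 32 % 16 := by omega
      rw [h8, h16] at hp
      generalize p % 32 = r at *
      clear h8 h16
      revert hp
      revert h32
      revert r
      decide
    rcases h with h | h
    · exact ⟨2, p ^ 2 / 32, by omega⟩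
    · exact ⟨4, p ^ 4 / 32, by omega⟩
  | succ n hn ih =>
    obtain ⟨j, k, h⟩ := ih
    obtain ⟨m, rfl⟩ := Nat.exists_eq_add_of_le' hn
    refine ⟨j * 2, k + 2 ^ (m + 2) * (2 * k + 1) ^ 2, ?_⟩
    rw [pow_mul, h]
    ring

section Nonsquare

variable {K : Type*} [Field K] [NumberField K] {n : ℕ} [IsCyclotomicExtension {2 ^ n} ℚ K] {ζ : K}

theorem not_isSquare_mk_rootUnit (hζ : IsPrimitiveRoot ζ (2 ^ n)) (hn : 1 ≤ n) {P : Ideal (𝓞 K)}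
    (hP : P.IsPrime) (h2 : 2 ∉ P) {p : ℕ} (hp : p.Prime) (hpP : (p : 𝓞 K) ∈ P) {j k : ℕ}
    (hj : p ^ j = 1 + 2 ^ n * (2 * k + 1)) :
    ¬ IsSquare (Ideal.Quotient.mk P (rootUnit hζ : 𝓞 K)) := by
  rintro ⟨x, hx⟩
  have hz : (rootUnit hζ : 𝓞 K) = hζ.toInteger := rfl
  rw [hz, ← pow_two] at hx
  have : Fact p.Prime := ⟨hp⟩
  have : CharP (𝓞 K ⧸ P) p := by
    have hp0 : ((p : ℕ) : 𝓞 K ⧸ P) = 0 := by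
      rw [← map_natCast (Ideal.Quotient.mk P)]
      exact Ideal.Quotient.eq_zero_iff_mem.2 hpP
    exact ringChar.of_eq (CharP.ringChar_of_prime_eq_zero hp hp0)
  have hζn : hζ.toInteger ^ 2 ^ n = 1 := hζ.toInteger_isPrimitiveRoot.pow_eq_one
  have hF : ((iterateFrobenius (𝓞 K ⧸ P) p j).comp (Ideal.Quotient.mk P)).toIntAlgHom
      = (Ideal.Quotient.mk P).toIntAlgHom := by
    refine AlgHom.ext_of_adjoin_eq_top (IsCyclotomicExtension.Rat.adjoin_singleton_eq_top hζ) ?_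
    rintro _ rfl
    change iterateFrobenius (𝓞 K ⧸ P) p j (Ideal.Quotient.mk P hζ.toInteger) = Ideal.Quotient.mk P hζ.toInteger
    rw [iterateFrobenius_def, ← map_pow, hj, pow_add, pow_mul, hζn, one_pow, pow_one, mul_one]
  obtain ⟨y, rfl⟩ := Ideal.Quotient.mk_surjective x
  have h1 : iterateFrobenius (𝓞 K ⧸ P) p j (Ideal.Quotient.mk P y) = Ideal.Quotient.mk P y :=
    congrArg (fun f : 𝓞 K →ₐ[ℤ] 𝓞 K ⧸ P => f y) hF
  obtain ⟨n, rfl⟩ := Nat.exists_eq_add_of_le' hn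
  have h3 : hζ.toInteger ^ 2 ^ n = -1 :=
    (hζ.toInteger_isPrimitiveRoot.pow (by positivity) (pow_succ 2 n)).eq_neg_one_of_two_right
  rw [iterateFrobenius_def, hj, pow_add, pow_one, pow_succ', mul_assoc, pow_mul, ← hx, pow_mul,
    ← map_pow, h3, ← map_pow, Odd.neg_one_pow ⟨k, rfl⟩,
    ← map_mul, Ideal.Quotient.mk_eq_mk_iff_sub_mem, mul_neg_one,
    show -y - y = -(2 * y) by ring, neg_mem_iff] at h1
  have hy := (hP.mem_or_mem h1).resolve_left h2
  rw [Ideal.Quotient.eq_zero_iff_mem.2 hy, zero_pow two_ne_zero, Ideal.Quotient.eq_zero_iff_mem] at hx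
  exact hP.ne_top (P.eq_top_of_isUnit_mem hx (rootUnit hζ).isUnit)

end Nonsquare

section Inert

variable {K L : Type*} [Field K] [NumberField K] [Field L] [NumberField L] [Algebra K L]
  [Algebra.IsQuadraticExtension K L] {σ : L ≃ₐ[K] L} {z : 𝓞 K} {η : 𝓞 L}

theorem exists_eq_add_mul {n : ℕ} [IsCyclotomicExtension {2 ^ n} ℚ L] {x : L}
    (hx : IsPrimitiveRoot x (2 ^ n)) (hz : hx.toInteger ^ 2 = algebraMap (𝓞 K) (𝓞 L) z) (y : 𝓞 L) :
    ∃ a b : 𝓞 K, y = algebraMap (𝓞 K) (𝓞 L) a + algebraMap (𝓞 K) (𝓞 L) b * hx.toInteger := by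
  have hy : y ∈ Algebra.adjoin ℤ {hx.toInteger} :=
    (IsCyclotomicExtension.Rat.adjoin_singleton_eq_top hx).ge trivial
  induction hy using Algebra.adjoin_induction with
  | mem x h => exact ⟨0, 1, by simpa using h⟩
  | algebraMap r => exact ⟨r, 0, by simp⟩
  | add x y _ _ hx hy =>
    obtain ⟨a, b, rfl⟩ := hx
    obtain ⟨c, e, rfl⟩ := hy
    exact ⟨a + c, b + e, by rw [map_add, map_add]; ring⟩
  | mul x y _ _ hx hy =>
    obtain ⟨a, b, rfl⟩ := hx
    obtain ⟨c, e, rfl⟩ := hy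
    refine ⟨a * c + b * e * z, a * e + b * c, ?_⟩
    simp only [map_add, map_mul, ← hz]
    ring

theorem eq_map_under (hηz : η ^ 2 = algebraMap (𝓞 K) (𝓞 L) z)
    (hdec : ∀ y : 𝓞 L, ∃ a b : 𝓞 K, y = algebraMap (𝓞 K) (𝓞 L) a + algebraMap (𝓞 K) (𝓞 L) b * η)
    {Q : Ideal (𝓞 L)} (hQ0 : Q ≠ ⊥) (hQ : Q.IsPrime)
    (hz : ¬ IsSquare (Ideal.Quotient.mk (Q.under (𝓞 K)) z)) :
    Q = (Q.under (𝓞 K)).map (algebraMap (𝓞 K) (𝓞 L)) := by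
  refine le_antisymm (fun y hy => ?_) Ideal.map_comap_le
  obtain ⟨a, b, rfl⟩ := hdec y
  have h1 : a ^ 2 - b ^ 2 * z ∈ Q.under (𝓞 K) := by
    rw [Ideal.mem_comap]
    have := Q.mul_mem_right (algebraMap (𝓞 K) (𝓞 L) a - algebraMap (𝓞 K) (𝓞 L) b * η) hy
    convert this using 1
    simp only [map_sub, map_mul, map_pow, ← hηz]
    ring
  have hP : (Q.under (𝓞 K)).IsMaximal :=
    (Ideal.IsPrime.under (𝓞 K) Q).isMaximal (under_ne_bot hQ0)
  have hb : b ∈ Q.under (𝓞 K) := by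
    by_contra hb
    let := Ideal.Quotient.field (Q.under (𝓞 K))
    have hb' : Ideal.Quotient.mk (Q.under (𝓞 K)) b ≠ 0 := mt Ideal.Quotient.eq_zero_iff_mem.1 hb
    rw [← Ideal.Quotient.mk_eq_mk_iff_sub_mem, map_mul, map_pow, map_pow] at h1
    refine hz ⟨Ideal.Quotient.mk _ a / Ideal.Quotient.mk _ b, ?_⟩
    rw [div_mul_div_comm, ← pow_two, ← pow_two, h1, mul_div_cancel_left₀ _ (pow_ne_zero 2 hb')]
  have ha : a ∈ Q.under (𝓞 K) := by
    refine hP.isPrime.mem_of_pow_mem 2 ?_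
    convert add_mem h1 (Ideal.mul_mem_right z _ (Ideal.mul_mem_left _ b hb)) using 1
    ring
  exact add_mem (Ideal.mem_map_of_mem _ ha) (Ideal.mul_mem_right _ _ (Ideal.mem_map_of_mem _ hb))

theorem isSquare_or_isSquare_mul {F : Type*} [Field F] [Finite F] {z : F} (hz : ¬ IsSquare z)
    (a : F) : IsSquare a ∨ IsSquare (a * z) := by
  by_contra! h
  have := Fintype.ofFinite F
  classical
  have hF : ringChar F ≠ 2 := fun hF => hz (FiniteField.isSquare_of_char_two hF z)
  have h1 := (quadraticChar_neg_one_iff_not_isSquare).2 h.1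
  have h2 := (quadraticChar_neg_one_iff_not_isSquare).2 h.2
  rw [map_mul, h1, quadraticChar_neg_one_iff_not_isSquare.2 hz] at h2
  norm_num at h2

theorem isSquare_mk_algebraMap (hηz : η ^ 2 = algebraMap (𝓞 K) (𝓞 L) z) (hzu : IsUnit z)
    {Q : Ideal (𝓞 L)} (hQ0 : Q ≠ ⊥) (hQ : Q.IsPrime)
    (hz : ¬ IsSquare (Ideal.Quotient.mk (Q.under (𝓞 K)) z)) (a : 𝓞 K) :
    IsSquare (Ideal.Quotient.mk Q (algebraMap (𝓞 K) (𝓞 L) a)) := by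
  have hP : (Q.under (𝓞 K)).IsMaximal :=
    (Ideal.IsPrime.under (𝓞 K) Q).isMaximal (under_ne_bot hQ0)
  have hQm : Q.IsMaximal := hQ.isMaximal hQ0
  let := Ideal.Quotient.field (Q.under (𝓞 K))
  let := Ideal.Quotient.field Q
  have : Finite (𝓞 K ⧸ Q.under (𝓞 K)) := Ideal.finiteQuotientOfFreeOfNeBot _ (under_ne_bot hQ0)
  have key : ∀ b : 𝓞 K, IsSquare (Ideal.Quotient.mk (Q.under (𝓞 K)) b) →
      IsSquare (Ideal.Quotient.mk Q (algebraMap (𝓞 K) (𝓞 L) b)) := fun b hb => by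
    have := hb.map (algebraMap (𝓞 K ⧸ Q.under (𝓞 K)) (𝓞 L ⧸ Q))
    rwa [Ideal.Quotient.algebraMap_mk_of_liesOver] at this
  rcases isSquare_or_isSquare_mul hz (Ideal.Quotient.mk _ a) with h | h
  · exact key a h
  · rw [← map_mul] at h
    have h' := key _ h
    rw [map_mul, map_mul, ← hηz, map_pow] at h'
    have hη : Ideal.Quotient.mk Q η ≠ 0 := by
      intro h0
      have : z ∈ Q.under (𝓞 K) := by
        rw [Ideal.mem_comap, ← hηz]
        exact Ideal.pow_mem_of_mem Q (Ideal.Quotient.eq_zero_iff_mem.1 h0) 2 two_pos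
      exact hP.ne_top (Ideal.eq_top_of_isUnit_mem _ this hzu)
    have h'' := h'.div (even_two.isSquare_pow (Ideal.Quotient.mk Q η))
    rwa [mul_div_cancel_right₀ _ (pow_ne_zero 2 hη)] at h''

theorem isSquare_mk_iff (hσ : σ ≠ 1) (hηz : η ^ 2 = algebraMap (𝓞 K) (𝓞 L) z) (hzu : IsUnit z)
    {Q : Ideal (𝓞 L)} (hQ0 : Q ≠ ⊥) (hQ : Q.IsPrime) (hQσ : Q.map (conj σ) = Q)
    (hz : ¬ IsSquare (Ideal.Quotient.mk (Q.under (𝓞 K)) z)) {u : 𝓞 L} {v : 𝓞 K}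
    (huv : algebraMap (𝓞 K) (𝓞 L) v = u * conj σ u) :
    IsSquare (Ideal.Quotient.mk Q u) ↔ IsSquare (Ideal.Quotient.mk (Q.under (𝓞 K)) v) := by
  have hQm : Q.IsMaximal := hQ.isMaximal hQ0
  let := Ideal.Quotient.field Q
  constructor
  · rintro ⟨y, hy⟩
    obtain ⟨y, rfl⟩ := Ideal.Quotient.mk_surjective y
    rw [← map_mul, Ideal.Quotient.mk_eq_mk_iff_sub_mem] at hy
    obtain ⟨w, hw⟩ := exists_algebraMap_eq_mul_conj hσ y
    refine ⟨Ideal.Quotient.mk _ w, ?_⟩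
    rw [← map_mul, Ideal.Quotient.mk_eq_mk_iff_sub_mem, Ideal.mem_comap, map_sub, map_mul, huv, hw]
    have hy' := hy
    rw [← hQσ, mem_map_conj hσ, map_sub, map_mul] at hy'
    convert add_mem (Q.mul_mem_right (conj σ u) hy) (Q.mul_mem_left (y * y) hy') using 1
    ring
  · rintro ⟨w, hw⟩
    obtain ⟨w, rfl⟩ := Ideal.Quotient.mk_surjective w
    rw [← map_mul, Ideal.Quotient.mk_eq_mk_iff_sub_mem, Ideal.mem_comap, map_sub, map_mul, huv] at hw
    by_cases hy : u + algebraMap (𝓞 K) (𝓞 L) w ∈ Q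
    · convert isSquare_mk_algebraMap hηz hzu hQ0 hQ hz (-w) using 1
      rw [Ideal.Quotient.mk_eq_mk_iff_sub_mem, map_neg, sub_neg_eq_add]
      exact hy
    obtain ⟨t, ht⟩ := exists_algebraMap_eq_mul_conj hσ (u + algebraMap (𝓞 K) (𝓞 L) w)
    have hy' : Ideal.Quotient.mk Q (algebraMap (𝓞 K) (𝓞 L) t) ≠ 0 := by
      rw [Ne, Ideal.Quotient.eq_zero_iff_mem, ht]
      intro h
      refine (hQ.mem_or_mem h).elim hy fun h => hy ?_
      rwa [← mem_map_conj hσ, hQσ] at h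
    have hmul : Ideal.Quotient.mk Q u * Ideal.Quotient.mk Q (algebraMap (𝓞 K) (𝓞 L) t)
        = Ideal.Quotient.mk Q (algebraMap (𝓞 K) (𝓞 L) w)
          * Ideal.Quotient.mk Q (u + algebraMap (𝓞 K) (𝓞 L) w) ^ 2 := by
      rw [← map_mul, ← map_pow, ← map_mul, Ideal.Quotient.mk_eq_mk_iff_sub_mem, ht, map_add,
        AlgEquiv.commutes]
      convert Q.mul_mem_left (u + algebraMap (𝓞 K) (𝓞 L) w) hw using 1
      ring
    rw [eq_div_of_mul_eq hy' hmul]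
    exact ((isSquare_mk_algebraMap hηz hzu hQ0 hQ hz w).mul (even_two.isSquare_pow _)).div
      (isSquare_mk_algebraMap hηz hzu hQ0 hQ hz t)

end Inert

section Comparison

variable {K L : Type*} [Field K] [NumberField K] [Field L] [NumberField L] [Algebra K L]
  [Algebra.IsQuadraticExtension K L] {σ : L ≃ₐ[K] L}

theorem exists_norm_units (hσ : σ ≠ 1) : ∃ N : (𝓞 L)ˣ →* (𝓞 K)ˣ,
    ∀ u : (𝓞 L)ˣ, algebraMap (𝓞 K) (𝓞 L) (N u : 𝓞 K) = u * conj σ u := by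
  refine ⟨Units.map (RingOfIntegers.norm K), fun u => RingOfIntegers.ext ?_⟩
  classical
  have : (Finset.univ : Finset (L ≃ₐ[K] L)) = {1, σ} := by
    ext τ
    simpa using aut_eq hσ τ
  refine (RingOfIntegers.coe_algebraMap_norm K (u : 𝓞 L)).trans ?_
  rw [Algebra.norm_eq_prod_automorphisms, this, Finset.prod_pair hσ.symm]
  rfl

theorem under_mem_primesAt {d : ℤ} {Q : Ideal (𝓞 L)} (hQ : Q ∈ primesAt L d) :
    Q.under (𝓞 K) ∈ primesAt K d := by
  have := hQ.1
  refine ⟨inferInstance, ?_⟩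
  rw [Ideal.mem_comap, map_intCast]
  exact hQ.2

theorem index_squareUnits_eq_and_ncard_primesAt_eq {n : ℕ} (hn : 4 ≤ n)
    [IsCyclotomicExtension {2 ^ n} ℚ K] [IsCyclotomicExtension {2 ^ (n + 1)} ℚ L] {d : ℤ}
    (hd : IsOddUnramified K d)
    (hall : ∀ p : ℕ, p.Prime → (p : ℤ) ∣ d →
      (p % 8 = 3 ∨ p % 8 = 5 ∨ p % 16 = 7 ∨ p % 16 = 9)) :
    (squareUnits L d).index = (squareUnits K d).index ∧
      (primesAt L d).ncard = (primesAt K d).ncard := by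
  have hd0 : d ≠ 0 := by
    rintro rfl
    exact absurd hd.odd (by simp)
  have hn1 : 1 ≤ n := by omega
  have hζ := IsCyclotomicExtension.zeta_spec (2 ^ n) ℚ K
  obtain ⟨x, hx⟩ := exists_sq_eq_algebraMap (L := L) hζ
  have hx' : IsPrimitiveRoot x (2 ^ (n + 1)) :=
    isPrimitiveRoot_of_sq hn1 (hx ▸ hζ.map_of_injective (algebraMap K L).injective)
  have hηz : hx'.toInteger ^ 2 = algebraMap (𝓞 K) (𝓞 L) (rootUnit hζ : 𝓞 K) := RingOfIntegers.ext hx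
  have hns : ∀ P ∈ primesAt K d, ¬ IsSquare (Ideal.Quotient.mk P (rootUnit hζ : 𝓞 K)) := by
    intro P hP
    obtain ⟨p, hp, hpd, hpm⟩ := exists_prime_of_mem_primesAt hd0 hP
    obtain ⟨j, k, hj⟩ := exists_pow_eq_one_add hn (hall p hp hpd)
    exact not_isSquare_mk_rootUnit hζ hn1 hP.1 (hd.two_notMem hP) hp
      (by simpa using (hpm p).2 dvd_rfl) hj
  have hmap : ∀ Q ∈ primesAt L d, Q = (Q.under (𝓞 K)).map (algebraMap (𝓞 K) (𝓞 L)) :=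
    fun Q hQ => eq_map_under hηz (exists_eq_add_mul hx' hηz) (ne_bot_of_mem_primesAt hd0 hQ) hQ.1
      (hns _ (under_mem_primesAt hQ))
  have hsurj : ∀ P ∈ primesAt K d, ∃ Q ∈ primesAt L d, Q.under (𝓞 K) = P := by
    intro P hP
    obtain ⟨Q, hQ, rfl⟩ := exists_prime_under_eq (L := L) hP.1
    refine ⟨Q, ⟨hQ, ?_⟩, rfl⟩
    have := hP.2
    rwa [Ideal.mem_comap, map_intCast] at this
  obtain ⟨σ, hσ⟩ := exists_aut_ne_one K L
  obtain ⟨N, hN⟩ := exists_norm_units hσ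
  have hreg := isTwoRegular_of_isCyclotomicExtension (by omega : 2 ≤ n) K
  obtain ⟨hL, htop⟩ := odd_card_and_normUnits_of_isCyclotomicExtension (by omega : 2 ≤ n) hσ hreg.odd_card
  have hNs : Function.Surjective N := by
    intro u
    obtain ⟨v, hv⟩ := exists_unit_mul_conj hσ hL (u := u) (htop.ge trivial)
    refine ⟨v, Units.ext (FaithfulSMul.algebraMap_injective (𝓞 K) (𝓞 L) ?_)⟩
    rw [hN, hv]
  constructor
  · have : squareUnits L d = (squareUnits K d).comap N := by
      ext u
      have key : ∀ Q ∈ primesAt L d, IsSquare (Ideal.Quotient.mk Q (u : 𝓞 L)) ↔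
          IsSquare (Ideal.Quotient.mk (Q.under (𝓞 K)) (N u : 𝓞 K)) := by
        intro Q hQ
        refine isSquare_mk_iff hσ hηz (rootUnit hζ).isUnit (ne_bot_of_mem_primesAt hd0 hQ) hQ.1 ?_
          (hns _ (under_mem_primesAt hQ)) (hN u)
        rw [hmap Q hQ, map_conj_map]
      constructor
      · intro hu P hP
        obtain ⟨Q, hQ, rfl⟩ := hsurj P hP
        exact (key Q hQ).1 (hu Q hQ)
      · intro hu Q hQ
        exact (key Q hQ).2 (hu _ (under_mem_primesAt hQ))
    rw [this, Subgroup.index_comap_of_surjective _ hNs]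
  · refine Set.ncard_congr (fun Q _ => Q.under (𝓞 K)) (fun Q hQ => under_mem_primesAt hQ) ?_ ?_
    · intro Q Q' hQ hQ' h
      rw [hmap Q hQ, hmap Q' hQ', h]
    · intro P hP
      obtain ⟨Q, hQ, h⟩ := hsurj P hP
      exact ⟨Q, hQ, h⟩

end Comparison

section Tower

variable {L : Type*} [Field L] [NumberField L] {d : ℤ} {ζ s : L} {n : ℕ}

theorem rank2_eq_log_sqIndex (L : Type*) [Field L] [NumberField L] :
    rank2 L = Nat.log 2 (sqIndex L) := by
  have : {x : ClassGroup (𝓞 L) | ∃ y, x = y ^ 2} =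
      (powMonoidHom 2 : ClassGroup (𝓞 L) →* ClassGroup (𝓞 L)).range := by
    ext x
    exact ⟨fun ⟨y, h⟩ => ⟨y, h.symm⟩, fun ⟨y, h⟩ => ⟨y, h.symm⟩⟩
  rw [rank2, this, Subgroup.closure_eq]
  rfl

theorem sqIndex_eq_one_of_odd (h : Odd (Nat.card (ClassGroup (𝓞 L)))) : sqIndex L = 1 := by
  rw [sqIndex, Subgroup.index_eq_one, MonoidHom.range_eq_top]
  exact (powCoprime (Nat.coprime_two_right.2 h)).surjective

theorem sqIndex_eq_one_of_mem (hn : 2 ≤ n) (hζ : IsPrimitiveRoot ζ (2 ^ n))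
    (hL : IntermediateField.adjoin ℚ {ζ, s} = ⊤) (hs : s ∈ IntermediateField.adjoin ℚ {ζ}) :
    sqIndex L = 1 := by
  have htop : IntermediateField.adjoin ℚ {ζ} = ⊤ := by
    rw [← top_le_iff, ← hL, IntermediateField.adjoin_le_iff, Set.insert_subset_iff,
      Set.singleton_subset_iff]
    exact ⟨IntermediateField.mem_adjoin_simple_self ℚ ζ, hs⟩
  have := hζ.intermediateField_adjoin_isCyclotomicExtension ℚ
  have : IsCyclotomicExtension {2 ^ n} ℚ L := IsCyclotomicExtension.equiv {2 ^ n} ℚ _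
    ((IntermediateField.equivOfEq htop).trans IntermediateField.topEquiv)
  exact sqIndex_eq_one_of_odd (odd_card_of_isCyclotomicExtension hn L)

theorem mem_adjoin_of_natAbs_eq_one (hn : 2 ≤ n) (hζ : IsPrimitiveRoot ζ (2 ^ n))
    (hd : d.natAbs = 1) (hs : s ^ 2 = d) : s ∈ IntermediateField.adjoin ℚ {ζ} := by
  have hζF : IsPrimitiveRoot (⟨ζ, IntermediateField.mem_adjoin_simple_self ℚ ζ⟩ :
      IntermediateField.adjoin ℚ {ζ}) (2 ^ n) :=
    IsPrimitiveRoot.of_map_of_injective (f := (IntermediateField.adjoin ℚ {ζ}).val) hζ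
      Subtype.val_injective
  obtain ⟨t, ht⟩ : ∃ t : IntermediateField.adjoin ℚ {ζ}, t ^ 2 = d := by
    obtain rfl | rfl := Int.natAbs_eq_iff.1 hd
    · exact ⟨1, by simp⟩
    · simpa using exists_sq_eq_neg_one_of_isPrimitiveRoot hn hζF
  have ht' : (t : L) ^ 2 = d := by exact_mod_cast congrArg Subtype.val ht
  obtain h | h := sq_eq_sq_iff_eq_or_eq_neg.1 (hs.trans ht'.symm)
  · exact h ▸ t.2
  · exact h ▸ neg_mem t.2

theorem isQuadraticExtension_of_adjoin {K : Type*} [Field K] [NumberField K] [Algebra K L]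
    {ξ : K} (hL : IntermediateField.adjoin ℚ {algebraMap K L ξ, s} = ⊤) (hs : s ^ 2 = d)
    (hdK : ¬ IsSquare (d : K)) : Algebra.IsQuadraticExtension K L where
  finrank_eq_two' := by
    have htop : IntermediateField.adjoin K {s} = ⊤ := by
      have : IntermediateField.adjoin ℚ {algebraMap K L ξ, s} ≤
          (IntermediateField.adjoin K {s}).restrictScalars ℚ := by
        rw [IntermediateField.adjoin_le_iff, Set.insert_subset_iff, Set.singleton_subset_iff]
        exact ⟨algebraMap_mem _ ξ, IntermediateField.mem_adjoin_simple_self K s⟩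
      rw [hL] at this
      exact top_le_iff.1 fun x _ => this (IntermediateField.mem_top (x := x))
    have hirr : Irreducible (Polynomial.X ^ 2 - Polynomial.C (d : K)) := by
      refine X_pow_sub_C_irreducible_of_prime Nat.prime_two fun b hb => hdK ⟨b, ?_⟩
      rw [← hb, pow_two]
    have hmin := minpoly.eq_of_irreducible_of_monic hirr (x := s) (by simp [hs])
      (Polynomial.monic_X_pow_sub_C _ two_ne_zero)
    have hsint : IsIntegral K s := Algebra.IsIntegral.isIntegral s
    rw [← IntermediateField.finrank_top', ← htop, IntermediateField.adjoin.finrank hsint, ← hmin,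
      Polynomial.natDegree_X_pow_sub_C]

theorem two_mul_sqIndex_mul_index_of_isCyclotomicExtension (K : Type*) [Field K] [NumberField K]
    [IsCyclotomicExtension {2 ^ n} ℚ K] (hn : 2 ≤ n) (hsf : Squarefree d) (hodd : Odd d)
    (hd : d.natAbs ≠ 1) (hζ : IsPrimitiveRoot ζ (2 ^ n)) (hs : s ^ 2 = d)
    (hL : IntermediateField.adjoin ℚ {ζ, s} = ⊤) :
    2 * sqIndex L * (squareUnits K d).index = 2 ^ (primesAt K d).ncard := by
  have hF : IsCyclotomicExtension {2 ^ n} ℚ (IntermediateField.adjoin ℚ {ζ}) :=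
    hζ.intermediateField_adjoin_isCyclotomicExtension ℚ
  let e : K ≃ₐ[ℚ] IntermediateField.adjoin ℚ {ζ} := IsCyclotomicExtension.algEquiv {2 ^ n} ℚ K _
  let : Algebra K L := ((IntermediateField.adjoin ℚ {ζ}).val.comp e.toAlgHom).toRingHom.toAlgebra
  have hξ : algebraMap K L (e.symm ⟨ζ, IntermediateField.mem_adjoin_simple_self ℚ ζ⟩) = ζ :=
    congrArg Subtype.val (e.apply_symm_apply _)
  obtain ⟨p, hp, hpd⟩ := Nat.exists_prime_and_dvd hd
  have hu : IsOddUnramified K d := isOddUnramified_of_isCyclotomicExtension (n := n) hsf hodd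
  have hdK := hu.not_isSquare (nonempty_primesAt hp (Int.natCast_dvd.2 hpd))
  have := isQuadraticExtension_of_adjoin (hξ.symm ▸ hL) hs hdK
  exact two_mul_sqIndex_mul_index L (isTwoRegular_of_isCyclotomicExtension hn K) hu hdK hs

theorem two_mul_sqIndex_mul_index_of_le {m : ℕ} (hm : 4 ≤ m) (hmn : m ≤ n)
    (K : Type*) [Field K] [NumberField K] [IsCyclotomicExtension {2 ^ n} ℚ K]
    (hsf : Squarefree d) (hodd : Odd d) (hd : d.natAbs ≠ 1)
    (hall : ∀ p : ℕ, p.Prime → (p : ℤ) ∣ d →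
      (p % 8 = 3 ∨ p % 8 = 5 ∨ p % 16 = 7 ∨ p % 16 = 9))
    (hζ : IsPrimitiveRoot ζ (2 ^ m)) (hs : s ^ 2 = d)
    (hL : IntermediateField.adjoin ℚ {ζ, s} = ⊤) :
    2 * sqIndex L * (squareUnits K d).index = 2 ^ (primesAt K d).ncard := by
  induction n, hmn using Nat.le_induction generalizing K with
  | base =>
    exact two_mul_sqIndex_mul_index_of_isCyclotomicExtension K (by omega) hsf hodd hd hζ hs hL
  | succ n hmn ih =>
    have hη := IsCyclotomicExtension.zeta_spec (2 ^ (n + 1)) ℚ K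
    let F := IntermediateField.adjoin ℚ {IsCyclotomicExtension.zeta (2 ^ (n + 1)) ℚ K ^ 2}
    have : IsCyclotomicExtension {2 ^ n} ℚ F := isCyclotomicExtension_adjoin_sq hη
    have := isQuadraticExtension_of_isCyclotomicExtension (L := K) (K := F) (by omega : 1 ≤ n)
    have hu : IsOddUnramified F d := isOddUnramified_of_isCyclotomicExtension (n := n) hsf hodd
    obtain ⟨h₁, h₂⟩ := index_squareUnits_eq_and_ncard_primesAt_eq (K := F) (L := K)
      (hm.trans hmn) hu hall
    rw [h₁, h₂]
    exact ih F

end Tower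

end QuadraticGenus

open QuadraticGenus

/-- If every prime divisor of the square-free integer d is ≡ ±3 (mod 8) or
≡ ±7 (mod 16), then for all n ≥ 4, rank₂(Cl(Q(ζ_{2^n}, √d))) = rank₂(Cl(Q(ζ_16, √d))). -/
theorem stmt_19 (d : ℤ) (hsf : Squarefree d)
    (hall : ∀ p : ℕ, p.Prime → (p : ℤ) ∣ d →
      (p % 8 = 3 ∨ p % 8 = 5 ∨ p % 16 = 7 ∨ p % 16 = 9))
    (n : ℕ) (hn : 4 ≤ n)
    (Ln : Type*) [Field Ln] [NumberField Ln] (ζn sn : Ln)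
    (hζn : IsPrimitiveRoot ζn (2 ^ n)) (hsn : sn ^ 2 = (d : Ln))
    (hLn : IntermediateField.adjoin ℚ {ζn, sn} = ⊤)
    (L4 : Type*) [Field L4] [NumberField L4] (ζ4 s4 : L4)
    (hζ4 : IsPrimitiveRoot ζ4 16) (hs4 : s4 ^ 2 = (d : L4))
    (hL4 : IntermediateField.adjoin ℚ {ζ4, s4} = ⊤) :
    rank2 Ln = rank2 L4 := by
  have hζ4' : IsPrimitiveRoot ζ4 (2 ^ 4) := by norm_num [hζ4]
  rw [rank2_eq_log_sqIndex, rank2_eq_log_sqIndex]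
  congr 1
  by_cases hd : d.natAbs = 1
  · rw [sqIndex_eq_one_of_mem (by omega) hζn hLn (mem_adjoin_of_natAbs_eq_one (by omega) hζn hd hsn),
      sqIndex_eq_one_of_mem (by omega) hζ4' hL4
        (mem_adjoin_of_natAbs_eq_one (by omega) hζ4' hd hs4)]
  have hodd : Odd d := by
    rw [← Int.not_even_iff_odd, even_iff_two_dvd]
    intro h
    simpa using hall 2 Nat.prime_two h
  have : NeZero ((2 ^ n : ℕ) : ℚ) := ⟨by simp⟩
  have : IsCyclotomicExtension {2 ^ n} ℚ (CyclotomicField (2 ^ n) ℚ) :=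
    CyclotomicField.isCyclotomicExtension _ _
  have h := two_mul_sqIndex_mul_index_of_le le_rfl hn (CyclotomicField (2 ^ n) ℚ) hsf hodd hd hall
    hζ4' hs4 hL4
  have h' := two_mul_sqIndex_mul_index_of_isCyclotomicExtension (CyclotomicField (2 ^ n) ℚ)
    (by omega) hsf hodd hd hζn hsn hLn
  have h0 : (squareUnits (CyclotomicField (2 ^ n) ℚ) d).index ≠ 0 := by
    intro h0
    rw [h0, mul_zero] at h
    exact (pow_pos two_pos _).ne h
  exact Nat.eq_of_mul_eq_mul_left two_pos
    (Nat.eq_of_mul_eq_mul_right (Nat.pos_of_ne_zero h0) (h'.trans h.symm))
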